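/- arXiv:0909.0694 — 2 statements merged into one kernel-verified Lean document; each statement's English description precedes it below -/
import Mathlib

section
/- For every n ≥ 1 there exists a flag simplicial complex Γ whose f-vector is the γ-vector of the type A_{n−1} Coxeter complex; that is, for every i ≥ 0 the number of faces of Γ of cardinality i equals #{w ∈ Pk_n : des(w) = i}. In particular this sequence satisfies the Kruskal–Katona inequalities. -/
open Finset

attribute [local instance] Classical.propDecidable

/-- The value `w_i` of the permutation word `w = w_1 ⋯ w_n` of `[n] = {1,…,n}`
(one-indexed); by convention the value is `0` outside the range, so `w_0 = 0`. -/
def pval (n : ℕ) (w : Equiv.Perm (Fin n)) (i : ℕ) : ℕ :=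
  if h : 1 ≤ i ∧ i ≤ n then ((w ⟨i - 1, by omega⟩ : Fin n) : ℕ) + 1 else 0

/-- The descent set of `w`: positions `i ∈ [n-1]` with `w_i > w_{i+1}`. -/
def desSet (n : ℕ) (w : Equiv.Perm (Fin n)) : Finset ℕ :=
  (Finset.Icc 1 (n - 1)).filter fun i => pval n w (i + 1) < pval n w i

/-- The number of descents of `w`. -/
def des (n : ℕ) (w : Equiv.Perm (Fin n)) : ℕ := (desSet n w).card

/-- `w ∈ Pk_n`: `w` has no double descents and no final descent. -/
def IsPk (n : ℕ) (w : Equiv.Perm (Fin n)) : Prop :=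
  (∀ i ∈ Finset.Icc 2 (n - 1),
      ¬(pval n w i < pval n w (i - 1) ∧ pval n w (i + 1) < pval n w i)) ∧
  ¬(pval n w n < pval n w (n - 1))

/-- A word has no double descents and no final descent: every descent is followed by an ascent. -/
def IsPkList : List ℕ → Prop
  | [] => True
  | [_] => True
  | x :: y :: l => IsPkList (y :: l) ∧ (y < x → ∃ z ∈ l.head?, y < z)

/-- The number of descents of a word. -/
def desList : List ℕ → ℕ
  | [] => 0
  | [_] => 0
  | x :: y :: l => desList (y :: l) + if y < x then 1 else 0

lemma isPkList_iff (l : List ℕ) :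
    IsPkList l ↔ ∀ i, i + 1 < l.length → l.getD (i + 1) 0 < l.getD i 0 →
      i + 2 < l.length ∧ l.getD (i + 1) 0 < l.getD (i + 2) 0 := by
  induction l with
  | nil => simp [IsPkList]
  | cons x l ih =>
    cases l with
    | nil => simp [IsPkList]
    | cons y l =>
      rw [IsPkList, ih]
      constructor
      · rintro ⟨h₁, h₂⟩ (_ | i) hi hlt
        · obtain ⟨z, hz, hyz⟩ := h₂ (by simpa using hlt)
          cases l with
          | nil => simp at hz
          | cons w l =>
            simp only [List.head?_cons, Option.mem_def, Option.some.injEq] at hz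
            subst hz
            simpa using hyz
        · have := h₁ i (by simpa using hi) (by simpa using hlt)
          simpa using this
      · intro h
        refine ⟨fun i hi hlt => ?_, fun hyx => ?_⟩
        · have := h (i + 1) (by simpa using hi) (by simpa using hlt)
          simpa using this
        · have := h 0 (by simp) (by simpa using hyx)
          cases l with
          | nil => simp at this
          | cons w l => exact ⟨w, by simp, by simpa using this⟩

lemma desList_eq_card (l : List ℕ) :
    desList l =
      #{i ∈ Finset.range (l.length - 1) | l.getD (i + 1) 0 < l.getD i 0} := by
  induction l with
  | nil => simp [desList]
  | cons x l ih =>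
    cases l with
    | nil => simp [desList]
    | cons y l =>
      rw [desList, ih, Finset.card_filter, Finset.card_filter]
      simp only [List.length_cons, add_tsub_cancel_right, Finset.sum_range_succ']
      simp

lemma isPkList_min_cons {a : ℕ} {v : List ℕ} (hv : ∀ x ∈ v, a < x) :
    IsPkList (a :: v) ↔ IsPkList v := by
  cases v with
  | nil => simp [IsPkList]
  | cons y v =>
    have : ¬ y < a := (hv y (by simp)).le.not_gt
    simp [IsPkList, this]

lemma desList_min_cons {a : ℕ} {v : List ℕ} (hv : ∀ x ∈ v, a < x) :
    desList (a :: v) = desList v := by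
  cases v with
  | nil => simp [desList]
  | cons y v =>
    have : ¬ y < a := (hv y (by simp)).le.not_gt
    simp [desList, this]

lemma isPkList_append_min {a : ℕ} {u v : List ℕ} (hu : ∀ x ∈ u, a < x) (hv : ∀ x ∈ v, a < x) :
    IsPkList (u ++ a :: v) ↔ IsPkList u ∧ IsPkList v ∧ (u = [] ∨ v ≠ []) := by
  induction u with
  | nil => simp [isPkList_min_cons hv, IsPkList]
  | cons x u ih =>
    have hx : a < x := hu x (by simp)
    have ih := ih fun y hy => hu y (by simp [hy])
    cases u with
    | nil =>
      simp only [List.cons_append, List.nil_append, IsPkList, isPkList_min_cons hv, hx]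
      cases v with
      | nil => simp
      | cons z v =>
        have := hv z (by simp)
        simp [this]
    | cons y u =>
      simp only [List.cons_append, IsPkList, ne_eq, reduceCtorEq, false_or] at ih ⊢
      rw [ih]
      cases u with
      | nil =>
        have : ¬ y < a := (hu y (by simp)).le.not_gt
        simp [this]
        tauto
      | cons z u => simp; tauto

lemma desList_append_min {a : ℕ} {u v : List ℕ} (hu : ∀ x ∈ u, a < x) (hv : ∀ x ∈ v, a < x) :
    desList (u ++ a :: v) = desList u + desList v + if u = [] then 0 else 1 := by
  induction u with
  | nil => simp [desList_min_cons hv, desList]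
  | cons x u ih =>
    have hx : a < x := hu x (by simp)
    have ih := ih fun y hy => hu y (by simp [hy])
    cases u with
    | nil => simp [desList, desList_min_cons hv, hx]
    | cons y u =>
      simp only [List.cons_append, desList, reduceCtorEq, if_false] at ih ⊢
      rw [ih]
      ring

/-- The arrangements of `A` without double descents and final descent. -/
noncomputable def pkWords (A : Finset ℕ) : Finset (List ℕ) :=
  {l ∈ A.toList.permutations.toFinset | IsPkList l}

lemma mem_pkWords {A : Finset ℕ} {l : List ℕ} :
    l ∈ pkWords A ↔ (l.Nodup ∧ l.toFinset = A) ∧ IsPkList l := by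
  simp only [pkWords, mem_filter, List.mem_toFinset, List.mem_permutations]
  refine and_congr_left fun _ => ⟨fun h => ⟨h.nodup_iff.2 A.nodup_toList, ?_⟩, ?_⟩
  · ext x; simp [h.mem_iff]
  · rintro ⟨hl, rfl⟩
    exact (List.toFinset_toList hl).symm

/-- The generating polynomial of `pkWords A` by number of descents. -/
noncomputable def pkPoly (A : Finset ℕ) : Polynomial ℕ :=
  ∑ l ∈ pkWords A, Polynomial.X ^ desList l

lemma pkPoly_empty : pkPoly ∅ = 1 := by
  have : pkWords ∅ = {[]} := by
    ext l
    rw [mem_pkWords, mem_singleton]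
    constructor
    · rintro ⟨⟨_, h⟩, _⟩
      simpa using h
    · rintro rfl
      simp [IsPkList]
  simp [pkPoly, this, desList]

lemma pkPoly_insert {a : ℕ} {B : Finset ℕ} (ha : ∀ x ∈ B, a < x) :
    pkPoly (insert a B) = ∑ S ∈ B.powerset with S = ∅ ∨ S ≠ B,
      (if S = ∅ then 1 else Polynomial.X) * (pkPoly S * pkPoly (B \ S)) := by
  have haB : a ∉ B := fun h => (ha a h).false
  simp only [pkPoly, Finset.sum_mul_sum]
  simp only [← Finset.sum_product']
  simp only [Finset.mul_sum]
  rw [Finset.sum_sigma']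
  symm
  have key : ∀ p ∈ (B.powerset.filter fun S => S = ∅ ∨ S ≠ B).sigma
      (fun S => pkWords S ×ˢ pkWords (B \ S)),
      (p.1 ⊆ B ∧ (p.1 = ∅ ∨ p.1 ≠ B)) ∧
      ((p.2.1.Nodup ∧ p.2.1.toFinset = p.1) ∧ IsPkList p.2.1) ∧
      ((p.2.2.Nodup ∧ p.2.2.toFinset = B \ p.1) ∧ IsPkList p.2.2) ∧
      (∀ x ∈ p.2.1, a < x) ∧ (∀ x ∈ p.2.2, a < x) := by
    rintro ⟨S, u, v⟩ hp
    simp only [mem_sigma, mem_filter, mem_powerset, mem_product, mem_pkWords] at hp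
    obtain ⟨h₁, h₂, h₃⟩ := hp
    refine ⟨h₁, h₂, h₃, fun x hx => ha x (h₁.1 ?_), fun x hx => ha x ?_⟩
    · rw [← h₂.1.2]; simpa using hx
    · have : x ∈ B \ S := by rw [← h₃.1.2]; simpa using hx
      exact (mem_sdiff.1 this).1
  refine Finset.sum_nbij (fun p => p.2.1 ++ a :: p.2.2) ?_ ?_ ?_ ?_
  · rintro ⟨S, u, v⟩ hp
    obtain ⟨⟨h₁, h₂⟩, ⟨⟨h₃, h₄⟩, h₅⟩, ⟨⟨h₆, h₇⟩, h₈⟩, hu, hv⟩ := key _ hp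
    dsimp only at *
    rw [mem_pkWords, isPkList_append_min hu hv]
    refine ⟨⟨?_, ?_⟩, h₅, h₈, ?_⟩
    · rw [List.nodup_append]
      refine ⟨h₃, List.nodup_cons.2 ⟨fun h => (hv a h).false, h₆⟩, ?_⟩
      intro x hx y hy hxy
      subst hxy
      rcases List.mem_cons.1 hy with rfl | hy
      · exact (hu x hx).false
      · rw [← List.mem_toFinset, h₄] at hx
        rw [← List.mem_toFinset, h₇] at hy
        exact (mem_sdiff.1 hy).2 hx
    · rw [List.toFinset_append, List.toFinset_cons, h₄, h₇, Finset.union_insert,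
        Finset.union_sdiff_of_subset h₁]
    · refine h₂.imp (fun h => ?_) (fun h => ?_)
      · rw [h] at h₄; simpa using h₄
      · rintro rfl
        exact h (h₁.antisymm (by simpa using h₇.symm))
  · rintro ⟨S, u, v⟩ hp ⟨S', u', v'⟩ hp' h
    obtain ⟨-, ⟨⟨-, h₄⟩, -⟩, -, hu, hv⟩ := key _ hp
    obtain ⟨-, ⟨⟨-, h₄'⟩, -⟩, -, hu', hv'⟩ := key _ hp'
    dsimp only at *
    rw [List.append_cons_inj_of_notMem (fun h => (hu _ h).false) (fun h => (hv _ h).false)] at h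
    obtain ⟨rfl, -, rfl⟩ := h
    rw [h₄] at h₄'
    subst h₄'
    rfl
  · intro l hl
    obtain ⟨⟨hnd, hl⟩, hpk⟩ := mem_pkWords.1 (mem_coe.1 hl)
    obtain ⟨u, v, rfl⟩ := List.append_of_mem
      (List.mem_toFinset.1 (hl.symm ▸ mem_insert_self a B) : a ∈ l)
    rw [List.nodup_append, List.nodup_cons] at hnd
    obtain ⟨hndu, ⟨hav, hndv⟩, hdis⟩ := hnd
    have hau : a ∉ u := fun h => hdis a h a (by simp) rfl
    have hB : ∀ x, x ∈ B ↔ x ∈ u ∨ x ∈ v := by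
      intro x
      have := congrArg (x ∈ ·) hl
      simp only [List.mem_toFinset, List.mem_append, List.mem_cons, mem_insert, eq_iff_iff] at this
      by_cases hx : x = a
      · subst hx; simp [haB, hau, hav]
      · simpa [hx] using this.symm
    have hu : ∀ x ∈ u, a < x := fun x hx => ha x ((hB x).2 (Or.inl hx))
    have hv : ∀ x ∈ v, a < x := fun x hx => ha x ((hB x).2 (Or.inr hx))
    rw [isPkList_append_min hu hv] at hpk
    refine ⟨⟨u.toFinset, u, v⟩, ?_, rfl⟩
    simp only [coe_sigma, Set.mem_sigma_iff, mem_coe, mem_filter, mem_powerset, mem_product,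
      mem_pkWords]
    refine ⟨⟨fun x hx => (hB x).2 (Or.inl (by simpa using hx)), ?_⟩,
      ⟨⟨hndu, trivial⟩, hpk.1⟩, ⟨hndv, ?_⟩, hpk.2.1⟩
    · refine hpk.2.2.imp (fun h => by simp [h]) (fun h h' => ?_)
      obtain ⟨x, hx⟩ := List.exists_mem_of_ne_nil v h
      have : x ∈ u.toFinset := h' ▸ (hB x).2 (Or.inr hx)
      exact hdis x (by simpa using this) x (by simp [hx]) rfl
    · ext x
      simp only [List.mem_toFinset, mem_sdiff, hB]
      exact ⟨fun hx => ⟨Or.inr hx, fun hx' => hdis x hx' x (by simp [hx]) rfl⟩, by tauto⟩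
  · rintro ⟨S, u, v⟩ hp
    obtain ⟨-, ⟨⟨-, h₄⟩, -⟩, -, hu, hv⟩ := key _ hp
    dsimp only at *
    rw [desList_append_min hu hv]
    have : S = ∅ ↔ u = [] := by rw [← h₄]; simp
    by_cases h : u = [] <;> simp [h, this] <;> ring

/-- The set `{0, …, k - 1} ∪ (S + k)`. -/
noncomputable def shiftSet (k : ℕ) (S : Finset ℕ) : Finset ℕ :=
  Finset.range k ∪ S.image (· + k)

lemma mem_shiftSet {k x : ℕ} {S : Finset ℕ} :
    x ∈ shiftSet k S ↔ x < k ∨ (k ≤ x ∧ x - k ∈ S) := by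
  simp only [shiftSet, mem_union, mem_range, mem_image]
  refine or_congr_right ⟨?_, fun h => ⟨x - k, h.2, by omega⟩⟩
  rintro ⟨y, hy, rfl⟩
  simpa using hy

lemma shiftSet_subset_shiftSet {k : ℕ} {S T : Finset ℕ} :
    shiftSet k S ⊆ shiftSet k T ↔ S ⊆ T := by
  constructor
  · intro h x hx
    have := @h (x + k) (mem_shiftSet.2 (Or.inr (by simpa using hx)))
    simpa [mem_shiftSet] using this
  · intro h x
    simp only [mem_shiftSet]
    exact Or.imp_right (And.imp_right (@h _))

lemma shiftSet_ssubset_shiftSet {k : ℕ} {S T : Finset ℕ} :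
    shiftSet k S ⊂ shiftSet k T ↔ S ⊂ T := by
  simp only [Finset.ssubset_def, shiftSet_subset_shiftSet]

lemma shiftSet_injective (k : ℕ) : Function.Injective (shiftSet k) := fun _ _ h =>
  (shiftSet_subset_shiftSet.1 h.le).antisymm (shiftSet_subset_shiftSet.1 h.ge)

lemma shiftSet_range (k m : ℕ) : shiftSet k (Finset.range m) = Finset.range (k + m) := by
  ext x
  simp only [mem_shiftSet, mem_range]
  omega

lemma shiftSet_empty (k : ℕ) : shiftSet k ∅ = Finset.range k := by simp [shiftSet]

lemma card_shiftSet (k : ℕ) (S : Finset ℕ) : #(shiftSet k S) = k + #S := by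
  rw [shiftSet, card_union_of_disjoint, card_range, card_image_of_injective _
    (add_left_injective k)]
  rw [Finset.disjoint_left]
  intro x
  simp only [mem_range, mem_image]
  rintro h ⟨y, -, rfl⟩
  omega

lemma exists_shiftSet_eq {k : ℕ} {T : Finset ℕ} (h : Finset.range k ⊆ T) :
    ∃ S, shiftSet k S = T := by
  refine ⟨{x ∈ T | k ≤ x}.image (· - k), ?_⟩
  ext x
  simp only [mem_shiftSet, mem_image, mem_filter]
  constructor
  · rintro (hx | ⟨hx, y, ⟨hy, hky⟩, hyx⟩)
    · exact h (mem_range.2 hx)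
    · rwa [show x = y by omega]
  · intro hx
    by_cases hk : x < k
    · exact Or.inl hk
    · exact Or.inr ⟨by omega, x, ⟨hx, by omega⟩, rfl⟩

/-- The vertices of the complex: pairs `(m, S)` with `m < n` and `S` a proper nonempty subset of
`{0, …, m - 1}`. -/
noncomputable def gammaVerts (n : ℕ) : Finset (ℕ × Finset ℕ) :=
  {p ∈ Finset.range n ×ˢ (Finset.range n).powerset | p.2.Nonempty ∧ p.2 ⊂ Finset.range p.1}

lemma mem_gammaVerts {n : ℕ} {p : ℕ × Finset ℕ} :
    p ∈ gammaVerts n ↔ p.1 < n ∧ p.2.Nonempty ∧ p.2 ⊂ Finset.range p.1 := by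
  simp only [gammaVerts, mem_filter, mem_product, mem_range, mem_powerset]
  refine ⟨fun h => ⟨h.1.1, h.2⟩, fun h => ⟨⟨h.1, ?_⟩, h.2⟩⟩
  exact h.2.2.subset.trans (Finset.range_subset_range.2 h.1.le)

/-- Adjacency of vertices, directed from the smaller to the larger first coordinate. -/
def GammaAdj (p q : ℕ × Finset ℕ) : Prop :=
  p.1 < q.1 ∧ (p.1 < #q.2 ∨ Finset.range #q.2 ⊂ p.2)

/-- Distinct elements of `F` are adjacent. -/
def IsGammaClique (F : Finset (ℕ × Finset ℕ)) : Prop :=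
  ∀ p ∈ F, ∀ q ∈ F, p ≠ q → GammaAdj p q ∨ GammaAdj q p

lemma IsGammaClique.subset {F G : Finset (ℕ × Finset ℕ)} (hF : IsGammaClique F) (h : G ⊆ F) :
    IsGammaClique G :=
  fun p hp q hq => hF p (h hp) q (h hq)

/-- The cliques on `gammaVerts n`. -/
noncomputable def gammaFaces (n : ℕ) : Finset (Finset (ℕ × Finset ℕ)) :=
  {F ∈ (gammaVerts n).powerset | IsGammaClique F}

lemma mem_gammaFaces {n : ℕ} {F : Finset (ℕ × Finset ℕ)} :
    F ∈ gammaFaces n ↔ F ⊆ gammaVerts n ∧ IsGammaClique F := by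
  simp [gammaFaces]

/-- The generating polynomial of `gammaFaces n` by cardinality. -/
noncomputable def facePoly (n : ℕ) : Polynomial ℕ :=
  ∑ F ∈ gammaFaces n, Polynomial.X ^ #F

/-- Translation of vertices by `k`. -/
noncomputable def shiftVert (k : ℕ) (p : ℕ × Finset ℕ) : ℕ × Finset ℕ :=
  (k + p.1, shiftSet k p.2)

lemma shiftVert_injective (k : ℕ) : Function.Injective (shiftVert k) := by
  rintro ⟨a, S⟩ ⟨b, T⟩ h
  simp only [shiftVert, Prod.mk.injEq, add_right_inj] at h
  rw [h.1, shiftSet_injective k h.2]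

lemma gammaAdj_shiftVert {k : ℕ} {p q : ℕ × Finset ℕ} :
    GammaAdj (shiftVert k p) (shiftVert k q) ↔ GammaAdj p q := by
  simp only [GammaAdj, shiftVert, card_shiftSet, ← shiftSet_range, shiftSet_ssubset_shiftSet,
    add_lt_add_iff_left]

lemma shiftVert_mem_gammaVerts {k n : ℕ} {p : ℕ × Finset ℕ} (hp : p ∈ gammaVerts n) :
    shiftVert k p ∈ gammaVerts (k + n) := by
  rw [mem_gammaVerts] at hp ⊢
  obtain ⟨h₁, ⟨x, hx⟩, h₂⟩ := hp
  refine ⟨by simpa [shiftVert] using h₁, ⟨x + k, ?_⟩, ?_⟩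
  · simpa [shiftVert, mem_shiftSet] using hx
  · simpa only [shiftVert, ← shiftSet_range, shiftSet_ssubset_shiftSet] using h₂

lemma exists_shiftVert_eq {k m : ℕ} {q : ℕ × Finset ℕ} (hq : q ∈ gammaVerts (k + m))
    (hk : k ≤ q.1) (h : Finset.range k ⊂ q.2) : ∃ p ∈ gammaVerts m, shiftVert k p = q := by
  obtain ⟨T, hT⟩ := exists_shiftSet_eq h.subset
  obtain ⟨a, U⟩ := q
  obtain ⟨b, rfl⟩ := Nat.exists_eq_add_of_le hk
  dsimp only at *
  subst hT
  refine ⟨(b, T), ?_, rfl⟩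
  rw [mem_gammaVerts] at hq ⊢
  dsimp only at *
  rw [← shiftSet_empty, shiftSet_ssubset_shiftSet] at h
  rw [← shiftSet_range, shiftSet_ssubset_shiftSet] at hq
  exact ⟨by omega, Finset.empty_ssubset.1 h, hq.2.2⟩

lemma gammaVerts_mono {m n : ℕ} (h : m ≤ n) : gammaVerts m ⊆ gammaVerts n := fun p hp => by
  rw [mem_gammaVerts] at hp ⊢
  exact ⟨hp.1.trans_le h, hp.2⟩

/-- A clique in the link of a vertex `(k + m, S)` with `#S = k`, from its two join factors. -/
noncomputable def joinFaces (k : ℕ) (A B : Finset (ℕ × Finset ℕ)) : Finset (ℕ × Finset ℕ) :=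
  A ∪ B.image (shiftVert k)

lemma fst_lt_of_mem_gammaFaces {n : ℕ} {F : Finset (ℕ × Finset ℕ)} (hF : F ∈ gammaFaces n)
    {p : ℕ × Finset ℕ} (hp : p ∈ F) : p.1 < n :=
  (mem_gammaVerts.1 ((mem_gammaFaces.1 hF).1 hp)).1

lemma mem_joinFaces_iff_left {k : ℕ} {A B : Finset (ℕ × Finset ℕ)} (hA : A ∈ gammaFaces k)
    {p : ℕ × Finset ℕ} : p ∈ A ↔ p ∈ joinFaces k A B ∧ p.1 < k := by
  simp only [joinFaces, mem_union, mem_image]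
  refine ⟨fun h => ⟨Or.inl h, fst_lt_of_mem_gammaFaces hA h⟩, ?_⟩
  rintro ⟨h | ⟨q, -, rfl⟩, hk⟩
  · exact h
  · simp [shiftVert] at hk

lemma mem_joinFaces_iff_right {k : ℕ} {A B : Finset (ℕ × Finset ℕ)} (hA : A ∈ gammaFaces k)
    {p : ℕ × Finset ℕ} : p ∈ B ↔ shiftVert k p ∈ joinFaces k A B := by
  simp only [joinFaces, mem_union, mem_image]
  refine ⟨fun h => Or.inr ⟨p, h, rfl⟩, ?_⟩
  rintro (h | ⟨q, hq, h⟩)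
  · have := fst_lt_of_mem_gammaFaces hA h
    simp [shiftVert] at this
  · rwa [← shiftVert_injective k h]

lemma card_joinFaces {k : ℕ} {A B : Finset (ℕ × Finset ℕ)} (hA : A ∈ gammaFaces k) :
    #(joinFaces k A B) = #A + #B := by
  rw [joinFaces, card_union_of_disjoint, card_image_of_injective _ (shiftVert_injective k)]
  rw [Finset.disjoint_left]
  intro p hp hp'
  obtain ⟨q, -, rfl⟩ := mem_image.1 hp'
  have := fst_lt_of_mem_gammaFaces hA hp
  simp [shiftVert] at this

lemma joinFaces_mem_gammaFaces {k m : ℕ} {A B : Finset (ℕ × Finset ℕ)}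
    (hA : A ∈ gammaFaces k) (hB : B ∈ gammaFaces m) : joinFaces k A B ∈ gammaFaces (k + m) := by
  rw [mem_gammaFaces] at hA hB ⊢
  have cross : ∀ p ∈ A, ∀ q, GammaAdj p (shiftVert k q) := fun p hp q => by
    have := (mem_gammaVerts.1 (hA.1 hp)).1
    simp only [GammaAdj, shiftVert, card_shiftSet]
    exact ⟨by omega, Or.inl (by omega)⟩
  constructor
  · refine union_subset (hA.1.trans (gammaVerts_mono (Nat.le_add_right k m))) fun p hp => ?_
    obtain ⟨q, hq, rfl⟩ := mem_image.1 hp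
    exact shiftVert_mem_gammaVerts (hB.1 hq)
  · intro p hp q hq hpq
    simp only [joinFaces, mem_union, mem_image] at hp hq
    rcases hp with hp | ⟨p, hp, rfl⟩ <;> rcases hq with hq | ⟨q, hq, rfl⟩
    · exact hA.2 p hp q hq hpq
    · exact Or.inl (cross p hp q)
    · exact Or.inr (cross q hq p)
    · simp only [gammaAdj_shiftVert]
      exact hB.2 p hp q hq fun h => hpq (h ▸ rfl)

lemma gammaAdj_of_mem_joinFaces {k m : ℕ} {A B : Finset (ℕ × Finset ℕ)}
    (hA : A ∈ gammaFaces k) (hB : B ∈ gammaFaces m) {S : Finset ℕ} (hS : #S = k)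
    {p : ℕ × Finset ℕ} (hp : p ∈ joinFaces k A B) : GammaAdj p (k + m, S) := by
  refine ⟨fst_lt_of_mem_gammaFaces (joinFaces_mem_gammaFaces hA hB) hp, ?_⟩
  simp only [joinFaces, mem_union, mem_image] at hp
  rcases hp with hp | ⟨p, hp, rfl⟩
  · exact Or.inl (hS ▸ fst_lt_of_mem_gammaFaces hA hp)
  · refine Or.inr ?_
    rw [hS, ← shiftSet_empty, shiftVert, shiftSet_ssubset_shiftSet]
    exact Finset.empty_ssubset.2 (mem_gammaVerts.1 ((mem_gammaFaces.1 hB).1 hp)).2.1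

lemma exists_joinFaces_eq {k m : ℕ} {F : Finset (ℕ × Finset ℕ)} (hF : F ∈ gammaFaces (k + m))
    {S : Finset ℕ} (hS : #S = k) (h : ∀ p ∈ F, GammaAdj p (k + m, S)) :
    ∃ A ∈ gammaFaces k, ∃ B ∈ gammaFaces m, joinFaces k A B = F := by
  rw [mem_gammaFaces] at hF
  refine ⟨{p ∈ F | p.1 < k}, ?_, {p ∈ gammaVerts m | shiftVert k p ∈ F}, ?_, ?_⟩
  · refine mem_gammaFaces.2 ⟨fun p hp => ?_, hF.2.subset (filter_subset _ _)⟩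
    rw [mem_filter] at hp
    exact mem_gammaVerts.2 ⟨hp.2, (mem_gammaVerts.1 (hF.1 hp.1)).2⟩
  · refine mem_gammaFaces.2 ⟨filter_subset _ _, fun p hp q hq hpq => ?_⟩
    rw [mem_filter] at hp hq
    simpa only [gammaAdj_shiftVert] using
      hF.2 _ hp.2 _ hq.2 ((shiftVert_injective k).ne hpq)
  · ext p
    simp only [joinFaces, mem_union, mem_image, mem_filter]
    constructor
    · rintro (hp | ⟨q, hq, rfl⟩)
      exacts [hp.1, hq.2]
    · intro hp
      by_cases hk : p.1 < k
      · exact Or.inl ⟨hp, hk⟩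
      · have hlt := (h p hp).2
        simp only [hS, hk, false_or] at hlt
        obtain ⟨q, hq, rfl⟩ := exists_shiftVert_eq (hF.1 hp) (not_lt.1 hk) hlt
        exact Or.inr ⟨q, ⟨hq, hp⟩, rfl⟩

lemma facePoly_zero : facePoly 0 = 1 := by
  have h : gammaFaces 0 = {∅} := by
    ext F
    have : gammaVerts 0 = ∅ := by ext p; simp [mem_gammaVerts]
    rw [mem_gammaFaces, this, subset_empty, mem_singleton, and_iff_left_iff_imp]
    rintro rfl
    simp [IsGammaClique]
  simp [facePoly, h]

lemma gammaFaces_mono {m n : ℕ} (h : m ≤ n) : gammaFaces m ⊆ gammaFaces n := fun F hF => by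
  rw [mem_gammaFaces] at hF ⊢
  exact ⟨hF.1.trans (gammaVerts_mono h), hF.2⟩

lemma insert_mem_gammaFaces_sdiff {n : ℕ} {F : Finset (ℕ × Finset ℕ)} (hF : F ∈ gammaFaces n)
    {S : Finset ℕ} (hS : S.Nonempty) (hSn : S ⊂ Finset.range n)
    (h : ∀ p ∈ F, GammaAdj p (n, S)) :
    insert (n, S) F ∈ gammaFaces (n + 1) \ gammaFaces n := by
  rw [mem_sdiff]
  refine ⟨mem_gammaFaces.2 ⟨?_, ?_⟩, fun hn => ?_⟩
  · refine insert_subset (mem_gammaVerts.2 ⟨by simp, hS, hSn⟩) ?_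
    exact (mem_gammaFaces.1 hF).1.trans (gammaVerts_mono n.le_succ)
  · intro p hp q hq hpq
    rcases mem_insert.1 hp with rfl | hp <;> rcases mem_insert.1 hq with rfl | hq
    · exact absurd rfl hpq
    · exact Or.inr (h q hq)
    · exact Or.inl (h p hp)
    · exact (mem_gammaFaces.1 hF).2 p hp q hq hpq
  · exact (fst_lt_of_mem_gammaFaces hn (mem_insert_self _ _)).false

lemma exists_insert_eq_of_mem_sdiff {n : ℕ} {F : Finset (ℕ × Finset ℕ)}
    (hF : F ∈ gammaFaces (n + 1) \ gammaFaces n) :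
    ∃ S : Finset ℕ, S.Nonempty ∧ S ⊂ Finset.range n ∧
      ∃ G ∈ gammaFaces n, (∀ p ∈ G, GammaAdj p (n, S)) ∧ insert (n, S) G = F := by
  rw [mem_sdiff, mem_gammaFaces, mem_gammaFaces] at hF
  obtain ⟨⟨hV, hcl⟩, hn⟩ := hF
  obtain ⟨⟨m, S⟩, hp, hpn⟩ := Finset.not_subset.1 fun h => hn ⟨h, hcl⟩
  have hpV := mem_gammaVerts.1 (hV hp)
  obtain rfl : m = n := by
    by_contra hmn
    refine hpn (mem_gammaVerts.2 ⟨?_, hpV.2⟩)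
    have := hpV.1
    dsimp only at this ⊢
    omega
  have hadj : ∀ q ∈ F.erase (m, S), GammaAdj q (m, S) := fun q hq => by
    rw [mem_erase] at hq
    refine (hcl q hq.2 _ hp hq.1).resolve_right fun h => ?_
    have h₁ := h.1
    have h₂ := (mem_gammaVerts.1 (hV hq.2)).1
    dsimp only at h₁
    omega
  refine ⟨S, hpV.2.1, hpV.2.2, F.erase (m, S), ?_, hadj, insert_erase hp⟩
  refine mem_gammaFaces.2 ⟨fun q hq => ?_, hcl.subset (erase_subset _ _)⟩
  exact mem_gammaVerts.2 ⟨(hadj q hq).1, (mem_gammaVerts.1 (hV (mem_of_mem_erase hq))).2⟩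

lemma facePoly_succ (n : ℕ) :
    facePoly (n + 1) = facePoly n + ∑ S ∈ (Finset.range n).powerset with
      S ≠ ∅ ∧ S ≠ Finset.range n, Polynomial.X * (facePoly #S * facePoly (n - #S)) := by
  rw [facePoly, ← Finset.sum_sdiff (gammaFaces_mono n.le_succ), add_comm]
  congr 1
  simp only [facePoly, Finset.sum_mul_sum]
  simp only [← Finset.sum_product']
  simp only [Finset.mul_sum]
  rw [Finset.sum_sigma']
  symm
  have key : ∀ p ∈ ((Finset.range n).powerset.filter fun S => S ≠ ∅ ∧ S ≠ Finset.range n).sigma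
      (fun S => gammaFaces #S ×ˢ gammaFaces (n - #S)),
      (p.1.Nonempty ∧ p.1 ⊂ Finset.range n) ∧ p.2.1 ∈ gammaFaces #p.1 ∧
        p.2.2 ∈ gammaFaces (n - #p.1) ∧ #p.1 + (n - #p.1) = n := by
    rintro ⟨S, A, B⟩ hp
    simp only [mem_sigma, mem_filter, mem_powerset, mem_product] at hp
    obtain ⟨⟨h₁, h₂, h₃⟩, h₄, h₅⟩ := hp
    refine ⟨⟨Finset.nonempty_iff_ne_empty.2 h₂, Finset.ssubset_iff_subset_ne.2 ⟨h₁, h₃⟩⟩,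
      h₄, h₅, ?_⟩
    have := Finset.card_le_card h₁
    rw [card_range] at this
    dsimp only
    omega
  have fresh : ∀ (S S' : Finset ℕ) (G : Finset (ℕ × Finset ℕ)), G ∈ gammaFaces n →
      (n, S) ∈ insert (n, S') G → S = S' := fun S S' G hG h => by
    rcases mem_insert.1 h with h | h
    · exact (Prod.mk.inj h).2
    · exact absurd (fst_lt_of_mem_gammaFaces hG h) (lt_irrefl n)
  have notMem : ∀ (S : Finset ℕ) (G : Finset (ℕ × Finset ℕ)), G ∈ gammaFaces n →
      (n, S) ∉ G := fun S G hG h => (fst_lt_of_mem_gammaFaces hG h).false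
  refine Finset.sum_nbij (fun p => insert (n, p.1) (joinFaces #p.1 p.2.1 p.2.2)) ?_ ?_ ?_ ?_
  · rintro ⟨S, A, B⟩ hp
    obtain ⟨⟨h₁, h₂⟩, hA, hB, hn⟩ := key _ hp
    refine insert_mem_gammaFaces_sdiff (hn ▸ joinFaces_mem_gammaFaces hA hB) h₁ h₂ fun p hp => ?_
    have := gammaAdj_of_mem_joinFaces hA hB rfl hp
    rwa [hn] at this
  · rintro ⟨S, A, B⟩ hp ⟨S', A', B'⟩ hp' h
    obtain ⟨-, hA, hB, hn⟩ := key _ hp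
    obtain ⟨-, hA', hB', hn'⟩ := key _ hp'
    have hJ := joinFaces_mem_gammaFaces hA hB
    have hJ' := joinFaces_mem_gammaFaces hA' hB'
    rw [hn] at hJ
    rw [hn'] at hJ'
    dsimp only at hA hB hA' hB' hJ hJ' h
    obtain rfl := fresh S S' _ hJ' (h ▸ mem_insert_self _ _)
    replace h := congrArg (Finset.erase · (n, S)) h
    rw [erase_insert (notMem _ _ hJ), erase_insert (notMem _ _ hJ')] at h
    obtain rfl : A = A' := by
      ext p
      rw [mem_joinFaces_iff_left (B := B) hA, mem_joinFaces_iff_left (B := B') hA', h]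
    obtain rfl : B = B' := by
      ext p
      rw [mem_joinFaces_iff_right hA, h, ← mem_joinFaces_iff_right hA]
    rfl
  · intro F hF
    obtain ⟨S, h₁, h₂, G, hG, hadj, rfl⟩ := exists_insert_eq_of_mem_sdiff (mem_coe.1 hF)
    have hn : #S + (n - #S) = n := by
      have := Finset.card_le_card h₂.subset
      rw [card_range] at this
      omega
    obtain ⟨A, hA, B, hB, rfl⟩ := exists_joinFaces_eq (m := n - #S) (S := S) (by rwa [hn]) rfl
      (by rwa [hn])
    refine ⟨⟨S, A, B⟩, ?_, rfl⟩
    simp only [coe_sigma, Set.mem_sigma_iff, mem_coe, mem_filter, mem_powerset, mem_product]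
    exact ⟨⟨h₂.subset, h₁.ne_empty, h₂.ne⟩, hA, hB⟩
  · rintro ⟨S, A, B⟩ hp
    obtain ⟨-, hA, hB, hn⟩ := key _ hp
    have hJ := joinFaces_mem_gammaFaces hA hB
    rw [hn] at hJ
    dsimp only at hA hB hJ ⊢
    rw [card_insert_of_notMem (notMem _ _ hJ), card_joinFaces hA]
    ring

lemma sum_proper_subsets_apply_card (B : Finset ℕ) (f : ℕ → Polynomial ℕ) :
    ∑ S ∈ B.powerset with S ≠ ∅ ∧ S ≠ B, f #S =
      ∑ j ∈ Finset.range (#B + 1), (#B).choose j • if j ≠ 0 ∧ j ≠ #B then f j else 0 := by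
  rw [← Finset.sum_powerset_apply_card (fun j => if j ≠ 0 ∧ j ≠ #B then f j else 0),
    Finset.sum_filter]
  refine Finset.sum_congr rfl fun S hS => ?_
  have h₁ : S ≠ ∅ ↔ #S ≠ 0 := not_congr Finset.card_eq_zero.symm
  have h₂ : S ≠ B ↔ #S ≠ #B :=
    not_congr ⟨fun h => h ▸ rfl, fun h => Finset.eq_of_subset_of_card_le (mem_powerset.1 hS) h.ge⟩
  simp only [h₁, h₂]

lemma pkPoly_eq_facePoly (A : Finset ℕ) : pkPoly A = facePoly #A := by
  induction A using Finset.strongInduction with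
  | H A ih =>
    rcases A.eq_empty_or_nonempty with rfl | hA
    · rw [pkPoly_empty, card_empty, facePoly_zero]
    · set a := A.min' hA
      set B := A.erase a
      have haB : a ∉ B := notMem_erase a A
      have hAB : insert a B = A := insert_erase (A.min'_mem hA)
      have hBA : B ⊂ A := erase_ssubset (A.min'_mem hA)
      have ha : ∀ x ∈ B, a < x := fun x hx => A.min'_lt_of_mem_erase_min' hA hx
      have hsplit : (B.powerset.filter fun S => S = ∅ ∨ S ≠ B) =
          insert ∅ (B.powerset.filter fun S => S ≠ ∅ ∧ S ≠ B) := by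
        ext S
        simp only [mem_filter, mem_insert, mem_powerset]
        by_cases hS : S = ∅ <;> simp [hS]
      rw [← hAB, card_insert_of_notMem haB, pkPoly_insert ha, facePoly_succ, hsplit,
        Finset.sum_insert (by simp), if_pos rfl, pkPoly_empty, one_mul, one_mul, sdiff_empty,
        ih B hBA]
      have h₁ := sum_proper_subsets_apply_card (Finset.range #B)
        fun j => Polynomial.X * (facePoly j * facePoly (#B - j))
      have h₂ := sum_proper_subsets_apply_card B
        fun j => Polynomial.X * (facePoly j * facePoly (#B - j))
      rw [card_range] at h₁
      refine congrArg (facePoly #B + ·) (Eq.trans ?_ (h₂.trans h₁.symm))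
      refine Finset.sum_congr rfl fun S hS => ?_
      simp only [mem_filter, mem_powerset] at hS
      rw [if_neg hS.2.1, ih S (hS.1.trans_ssubset hBA), ih (B \ S) (sdiff_subset.trans_ssubset hBA),
        card_sdiff_of_subset hS.1]

lemma coeff_sum_X_pow {ι : Type*} (s : Finset ι) (f : ι → ℕ) (i : ℕ) :
    (∑ x ∈ s, (Polynomial.X : Polynomial ℕ) ^ f x).coeff i = #{x ∈ s | f x = i} := by
  simp only [Polynomial.finsetSum_coeff, Polynomial.coeff_X_pow, Finset.card_filter, eq_comm]

/-- The word of a permutation, with letters in `{0, …, n - 1}`. -/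
def permWord (n : ℕ) (w : Equiv.Perm (Fin n)) : List ℕ := List.ofFn fun j => (w j : ℕ)

lemma length_permWord (n : ℕ) (w : Equiv.Perm (Fin n)) : (permWord n w).length = n := by
  simp [permWord]

lemma pval_succ {n : ℕ} (w : Equiv.Perm (Fin n)) {i : ℕ} (hi : i < n) :
    pval n w (i + 1) = (permWord n w).getD i 0 + 1 := by
  rw [pval, dif_pos ⟨by omega, by omega⟩]
  simp [permWord, hi]

lemma isPk_iff {n : ℕ} (w : Equiv.Perm (Fin n)) : IsPk n w ↔ IsPkList (permWord n w) := by
  rw [isPkList_iff, length_permWord]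
  have inj : ∀ i, i + 1 < n → (permWord n w).getD i 0 ≠ (permWord n w).getD (i + 1) 0 := by
    intro i hi h
    simp [permWord, hi, (Nat.lt_succ_self i).trans hi, Fin.val_inj] at h
  constructor
  · rintro ⟨h₁, h₂⟩ i hi hlt
    rcases Nat.lt_or_ge (i + 2) n with hi' | hi'
    · refine ⟨hi', ?_⟩
      have := h₁ (i + 2) (mem_Icc.2 ⟨by omega, by omega⟩)
      rw [show i + 2 - 1 = i + 1 by omega, pval_succ w (i := i) (by omega),
        pval_succ w hi, pval_succ w hi'] at this
      have : (permWord n w).getD (i + 1) 0 ≠ (permWord n w).getD (i + 2) 0 := inj (i + 1) hi'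
      omega
    · obtain rfl : n = i + 2 := by omega
      rw [show i + 2 - 1 = i + 1 by omega, pval_succ w (i := i) (by omega),
        pval_succ w hi] at h₂
      omega
  · intro h
    constructor
    · intro j hj
      obtain ⟨h₁, h₂⟩ := mem_Icc.1 hj
      obtain ⟨i, rfl⟩ := Nat.exists_eq_add_of_le' h₁
      rw [show i + 2 - 1 = i + 1 by omega, pval_succ w (i := i) (by omega),
        pval_succ w (i := i + 1) (by omega), pval_succ w (i := i + 2) (by omega)]
      have := h i (by omega)
      omega
    · intro hlt
      rcases Nat.lt_or_ge n 2 with hn | hn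
      · have h₀ : pval n w (n - 1) = 0 := by
          rw [pval, dif_neg]
          omega
        omega
      · obtain ⟨i, rfl⟩ := Nat.exists_eq_add_of_le' hn
        rw [show i + 2 - 1 = i + 1 by omega, pval_succ w (i := i) (by omega),
          pval_succ w (i := i + 1) (by omega)] at hlt
        have := h i (by omega) (by omega)
        omega

lemma des_eq {n : ℕ} (w : Equiv.Perm (Fin n)) : des n w = desList (permWord n w) := by
  rw [desList_eq_card, length_permWord, des, desSet]
  symm
  refine Finset.card_nbij (· + 1) ?_ (fun _ _ _ _ h => by simpa using h) ?_
  · intro i hi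
    simp only [mem_coe, mem_filter, mem_range, mem_Icc] at hi ⊢
    rw [pval_succ w (i := i) (by omega), pval_succ w (i := i + 1) (by omega)]
    omega
  · intro j hj
    simp only [coe_filter, mem_Icc, Set.mem_ofPred_eq] at hj
    obtain ⟨i, rfl⟩ := Nat.exists_eq_add_of_le' hj.1.1
    rw [pval_succ w (i := i) (by omega), pval_succ w (i := i + 1) (by omega)] at hj
    refine ⟨i, ?_, rfl⟩
    simp only [coe_filter, mem_range, Set.mem_ofPred_eq]
    omega

lemma card_isPk_des_eq (n i : ℕ) :
    #{w : Equiv.Perm (Fin n) | IsPk n w ∧ des n w = i} =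
      #{l ∈ pkWords (Finset.range n) | desList l = i} := by
  refine Finset.card_nbij (permWord n) ?_ ?_ ?_
  · intro w hw
    simp only [mem_coe, mem_filter, mem_univ, true_and, isPk_iff, des_eq] at hw
    simp only [mem_coe, mem_filter, mem_pkWords]
    refine ⟨⟨⟨?_, ?_⟩, hw.1⟩, hw.2⟩
    · exact List.nodup_ofFn.2 (Fin.val_injective.comp w.injective)
    · ext x
      simp only [permWord, List.mem_toFinset, List.mem_ofFn, mem_range]
      constructor
      · rintro ⟨j, rfl⟩
        exact (w j).2
      · intro hx
        exact ⟨w.symm ⟨x, hx⟩, by simp⟩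
  · intro w _ w' _ h
    ext j
    exact congrFun (List.ofFn_injective h) j
  · intro l hl
    simp only [coe_filter, mem_pkWords, Set.mem_ofPred_eq] at hl
    obtain ⟨⟨⟨hnd, hset⟩, hpk⟩, hdes⟩ := hl
    have hlen : l.length = n := by
      rw [← List.toFinset_card_of_nodup hnd, hset, card_range]
    subst hlen
    have hmem : ∀ j : Fin l.length, l.get j < l.length := fun j => by
      rw [← mem_range, ← hset, List.mem_toFinset]
      exact List.get_mem l j
    have hinj : Function.Injective fun j : Fin l.length => (⟨l.get j, hmem j⟩ : Fin l.length) :=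
      fun a b h => hnd.injective_get (Fin.mk.inj h)
    have hw : permWord l.length
        (Equiv.ofBijective _ (Finite.injective_iff_bijective.1 hinj)) = l := by
      simp [permWord]
    refine ⟨_, ?_, hw⟩
    simp only [coe_filter, mem_univ, true_and, Set.mem_ofPred_eq, isPk_iff, des_eq]
    rw [hw]
    exact ⟨hpk, hdes⟩

/-- There is a flag simplicial complex whose `f`-vector is the `γ`-vector of the
type `A_{n-1}` Coxeter complex: its number of faces of cardinality `i` is
`#{w ∈ Pk_n : des w = i}`.  (In particular this sequence satisfies the
Kruskal–Katona inequalities.) -/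
theorem gamma_typeA_is_f_vector_of_flag_complex (n : ℕ) (hn : 1 ≤ n) :
    ∃ (V : Type) (_ : Fintype V) (_ : DecidableEq V) (Δ : Finset (Finset V)),
      ∅ ∈ Δ ∧
      (∀ F ∈ Δ, ∀ G ⊆ F, G ∈ Δ) ∧
      (∀ v : V, ({v} : Finset V) ∈ Δ) ∧
      (∀ F : Finset V,
        (∀ a ∈ F, ∀ b ∈ F, a ≠ b → ({a, b} : Finset V) ∈ Δ) → F ∈ Δ) ∧
      (∀ i : ℕ, (Δ.filter fun F => F.card = i).card =
        (Finset.univ.filter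
          fun w : Equiv.Perm (Fin n) => IsPk n w ∧ des n w = i).card) := by
  classical
  let e : gammaVerts n ↪ ℕ × Finset ℕ := Function.Embedding.subtype _
  refine ⟨gammaVerts n, inferInstance, inferInstance,
    Finset.univ.filter fun F : Finset (gammaVerts n) => IsGammaClique (F.map e), ?_, ?_, ?_, ?_, fun i => ?_⟩
  · simp [IsGammaClique]
  · intro F hF G hGF
    rw [mem_filter] at hF ⊢
    exact ⟨mem_univ _, hF.2.subset (map_subset_map.2 hGF)⟩
  · intro v
    refine mem_filter.2 ⟨mem_univ _, ?_⟩
    rw [map_singleton]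
    intro p hp q hq h
    exact absurd ((mem_singleton.1 hp).trans (mem_singleton.1 hq).symm) h
  · intro F hF
    simp only [mem_filter, mem_univ, true_and] at hF ⊢
    intro p hp q hq hpq
    obtain ⟨a, ha, rfl⟩ := mem_map.1 hp
    obtain ⟨b, hb, rfl⟩ := mem_map.1 hq
    exact hF a ha b hb (fun h => hpq (h ▸ rfl)) _ (mem_map_of_mem e (by simp)) _
      (mem_map_of_mem e (by simp)) hpq
  · have h := congrArg (Polynomial.coeff · i) (pkPoly_eq_facePoly (Finset.range n))
    simp only [pkPoly, facePoly, coeff_sum_X_pow, card_range] at h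
    rw [card_isPk_des_eq, h]
    refine Finset.card_nbij (Finset.map e) ?_ ((Finset.map_injective e).injOn) ?_
    · intro F hF
      simp only [mem_coe, mem_filter, mem_univ, true_and] at hF
      simp only [mem_coe, mem_filter, mem_gammaFaces, card_map]
      refine ⟨⟨fun p hp => ?_, hF.1⟩, hF.2⟩
      obtain ⟨a, -, rfl⟩ := mem_map.1 hp
      exact a.2
    · intro F hF
      simp only [coe_filter, mem_gammaFaces, Set.mem_ofPred_eq] at hF
      have hmap : (F.subtype (· ∈ gammaVerts n)).map e = F :=
        Finset.subtype_map_of_mem fun p hp => hF.1.1 hp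
      refine ⟨F.subtype (· ∈ gammaVerts n), ?_, hmap⟩
      simp only [coe_filter, mem_filter, mem_univ, true_and, Set.mem_ofPred_eq]
      rw [hmap, ← card_map e, hmap]
      exact ⟨hF.1.2, hF.2⟩
end

section
/- For every n ≥ 1 there exists a flag simplicial complex Γ whose f-vector is the γ-vector of the type B_n Coxeter complex; that is, for every i ≥ 0 the number of faces of Γ of cardinality i equals 4^i · #{w ∈ S_n : pk(0w) = i}. In particular this sequence satisfies the Kruskal–Katona inequalities. -/
open Finset

attribute [local instance] Classical.propDecidable

/-- The set of peaks of `0w`: positions `i ∈ [n-1]` with `w_{i-1} < w_i > w_{i+1}`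
(where `w_0 = 0`). -/
def pkSet (n : ℕ) (w : Equiv.Perm (Fin n)) : Finset ℕ :=
  (Finset.Icc 1 (n - 1)).filter fun i =>
    pval n w (i - 1) < pval n w i ∧ pval n w (i + 1) < pval n w i

/-- `pk(0w)`, the number of peaks of `0w`. -/
def pk (n : ℕ) (w : Equiv.Perm (Fin n)) : ℕ := (pkSet n w).card

open Polynomial

/-- A finite set is a clique of the relation `r` if any two distinct elements are related. -/
def IsCliqueOf {α : Type*} (r : α → α → Prop) (F : Finset α) : Prop :=
  ∀ a ∈ F, ∀ b ∈ F, a ≠ b → r a b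

/-- The finset of cliques of `r` contained in `V`. -/
noncomputable def cliquesIn {α : Type*} (r : α → α → Prop) (V : Finset α) :
    Finset (Finset α) :=
  V.powerset.filter (IsCliqueOf r)

/-- The generating polynomial of cliques of `r` contained in `V`, by cardinality. -/
noncomputable def cliquePoly {α : Type*} (r : α → α → Prop) (V : Finset α) : ℚ[X] :=
  ∑ F ∈ cliquesIn r V, X ^ F.card

section Clique

variable {α β : Type*}

lemma mem_cliquesIn {r : α → α → Prop} {V F : Finset α} :
    F ∈ cliquesIn r V ↔ F ⊆ V ∧ IsCliqueOf r F := by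
  simp [cliquesIn]

lemma cliquePoly_empty (r : α → α → Prop) : cliquePoly r ∅ = 1 := by
  have : cliquesIn r ∅ = {∅} := by
    ext F
    rw [mem_cliquesIn]
    simp only [subset_empty, mem_singleton, and_iff_left_iff_imp]
    rintro rfl
    simp [IsCliqueOf]
  simp [cliquePoly, this]

lemma cliquePoly_insert [DecidableEq α] {r : α → α → Prop} (hr : ∀ a b, r a b → r b a) {V : Finset α} {v : α}
    (hv : v ∉ V) :
    cliquePoly r (insert v V) = cliquePoly r V + X * cliquePoly r (V.filter (r v)) := by
  have hsplit : cliquesIn r (insert v V) =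
      cliquesIn r V ∪ (cliquesIn r (V.filter (r v))).image (insert v) := by
    ext F
    simp only [mem_union, mem_image, mem_cliquesIn]
    constructor
    · rintro ⟨hF, hc⟩
      by_cases hvF : v ∈ F
      · right
        refine ⟨F.erase v, ⟨?_, ?_⟩, insert_erase hvF⟩
        · intro x hx
          obtain ⟨hxv, hxF⟩ := mem_erase.1 hx
          exact mem_filter.2 ⟨(mem_insert.1 (hF hxF)).resolve_left hxv, hc v hvF x hxF hxv.symm⟩
        · exact fun a ha b hb => hc a (mem_of_mem_erase ha) b (mem_of_mem_erase hb)
      · exact Or.inl ⟨(subset_insert_iff_of_notMem hvF).1 hF, hc⟩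
    · rintro (⟨hF, hc⟩ | ⟨G, ⟨hG, hc⟩, rfl⟩)
      · exact ⟨hF.trans (subset_insert _ _), hc⟩
      · refine ⟨insert_subset_insert _ (hG.trans (filter_subset _ _)), ?_⟩
        intro a ha b hb hab
        rcases mem_insert.1 ha with rfl | ha' <;> rcases mem_insert.1 hb with rfl | hb'
        · exact absurd rfl hab
        · exact (mem_filter.1 (hG hb')).2
        · exact hr _ _ (mem_filter.1 (hG ha')).2
        · exact hc a ha' b hb' hab
  have hnot : ∀ G ∈ cliquesIn r (V.filter (r v)), v ∉ G := fun G hG h =>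
    hv (mem_filter.1 ((mem_cliquesIn.1 hG).1 h)).1
  have hdisj : Disjoint (cliquesIn r V) ((cliquesIn r (V.filter (r v))).image (insert v)) := by
    rw [disjoint_left]
    rintro F hF hF'
    obtain ⟨G, -, rfl⟩ := mem_image.1 hF'
    exact hv ((mem_cliquesIn.1 hF).1 (mem_insert_self _ _))
  have hinj : Set.InjOn (insert v) (cliquesIn r (V.filter (r v)) : Set (Finset α)) := by
    intro G hG G' hG' h
    rw [← erase_insert (hnot G hG), ← erase_insert (hnot G' hG'), h]
  rw [cliquePoly, hsplit, sum_union hdisj, sum_image hinj]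
  simp only [cliquePoly, mul_sum]
  congr 1
  refine sum_congr rfl fun G hG => ?_
  rw [card_insert_of_notMem (hnot G hG), pow_succ']

lemma cliquePoly_union_indep [DecidableEq α] {r : α → α → Prop} (hr : ∀ a b, r a b → r b a) (V N : Finset α)
    (hVN : Disjoint V N) (hN : ∀ a ∈ N, ∀ b ∈ N, ¬ r a b) :
    cliquePoly r (V ∪ N) = cliquePoly r V + X * ∑ v ∈ N, cliquePoly r (V.filter (r v)) := by
  induction N using Finset.induction_on with
  | empty => simp
  | insert a N ha ih =>
    rw [disjoint_insert_right] at hVN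
    have haV : a ∉ V ∪ N := by simp [hVN.1, ha]
    have hfil : (V ∪ N).filter (r a) = V.filter (r a) := by
      rw [filter_union, (filter_eq_empty_iff (s := N)).2, union_empty]
      exact fun b hb => hN a (mem_insert_self _ _) b (mem_insert_of_mem hb)
    rw [union_insert, cliquePoly_insert hr haV, hfil, sum_insert ha,
      ih hVN.2 fun b hb c hc => hN b (mem_insert_of_mem hb) c (mem_insert_of_mem hc)]
    ring

lemma cliquePoly_join [DecidableEq α] {r : α → α → Prop} (hr : ∀ a b, r a b → r b a) (V W : Finset α)
    (hd : Disjoint V W) (h : ∀ a ∈ V, ∀ b ∈ W, r a b) :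
    cliquePoly r (V ∪ W) = cliquePoly r V * cliquePoly r W := by
  induction V using Finset.strongInduction with
  | H V ih =>
    rcases V.eq_empty_or_nonempty with rfl | ⟨v, hv⟩
    · simp [cliquePoly_empty]
    have hvW : v ∉ W := disjoint_left.1 hd hv
    have hsub : ∀ U : Finset α, U ⊂ V → cliquePoly r (U ∪ W) = cliquePoly r U * cliquePoly r W :=
      fun U hU => ih U hU (hd.mono_left hU.subset) fun a ha => h a (hU.subset ha)
    have hss : V.erase v ⊂ V := erase_ssubset hv
    have hfil : (V.erase v ∪ W).filter (r v) = (V.erase v).filter (r v) ∪ W := by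
      rw [filter_union, filter_true_of_mem (h v hv)]
    have h1 := cliquePoly_insert hr (V := V.erase v ∪ W) (v := v) (by simp [hvW])
    have h2 := cliquePoly_insert hr (V := V.erase v) (v := v) (by simp)
    rw [← insert_union, insert_erase hv, hfil, hsub _ hss,
      hsub _ ((filter_subset _ _).trans_ssubset hss)] at h1
    rw [insert_erase hv] at h2
    rw [h1, h2]
    ring

lemma cliquePoly_map {r : α → α → Prop} {r' : β → β → Prop} (e : α ↪ β)
    (h : ∀ a b, r' (e a) (e b) ↔ r a b) (V : Finset α) :
    cliquePoly r' (V.map e) = cliquePoly r V := by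
  have hcl : cliquesIn r' (V.map e) = (cliquesIn r V).map (mapEmbedding e).toEmbedding := by
    ext F
    simp only [mem_map, mem_cliquesIn, RelEmbedding.coe_toEmbedding, mapEmbedding_apply]
    constructor
    · rintro ⟨hF, hc⟩
      obtain ⟨G, hG, rfl⟩ := subset_map_iff.1 hF
      refine ⟨G, ⟨hG, fun a ha b hb hab => ?_⟩, rfl⟩
      exact (h a b).1 (hc _ (mem_map_of_mem e ha) _ (mem_map_of_mem e hb) (by simpa using hab))
    · rintro ⟨G, ⟨hG, hc⟩, rfl⟩
      refine ⟨map_subset_map.2 hG, ?_⟩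
      intro a ha b hb hab
      obtain ⟨a, ha', rfl⟩ := mem_map.1 ha
      obtain ⟨b, hb', rfl⟩ := mem_map.1 hb
      exact (h a b).2 (hc a ha' b hb' fun h => hab (by rw [h]))
  simp [cliquePoly, hcl]

lemma coeff_cliquePoly (r : α → α → Prop) (V : Finset α) (i : ℕ) :
    (cliquePoly r V).coeff i = (((cliquesIn r V).filter fun F => F.card = i).card : ℚ) := by
  simp [cliquePoly, coeff_X_pow, eq_comm]

end Clique

/-- `TriLink (s, j, a) (r, k, b)` says that `(r, k, b)` belongs to an earlier stage than `(s, j, a)`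
and lies in the prescribed link of `(s, j, a)`. -/
def TriLink (x y : ℕ × ℕ × ℕ) : Prop :=
  y.1 < x.1 ∧ (y.1 < x.2.1 ∨
    (x.2.1 < y.2.1 ∧ y.2.2 < (y.1 - x.2.1).choose (y.2.1 - x.2.1)))

/-- The symmetric closure of `TriLink`. -/
def TriAdj (x y : ℕ × ℕ × ℕ) : Prop := TriLink x y ∨ TriLink y x

/-- Iterated dependent pairs of naturals as triples. -/
def sigmaTriple : ((_ : ℕ) × (_ : ℕ) × ℕ) ↪ ℕ × ℕ × ℕ where
  toFun x := (x.1, x.2.1, x.2.2)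
  inj' := by
    rintro ⟨a, b, c⟩ ⟨a', b', c'⟩ h
    simp_all

lemma sigmaTriple_apply (x : (_ : ℕ) × (_ : ℕ) × ℕ) : sigmaTriple x = (x.1, x.2.1, x.2.2) := rfl

/-- Triples `(s, j, a)` with `1 ≤ j < s < n` and `a < s.choose j`. -/
def vertA (n : ℕ) : Finset (ℕ × ℕ × ℕ) :=
  ((range n).sigma fun s => (Ico 1 s).sigma fun j => range (s.choose j)).map
    sigmaTriple

/-- Triples `(s, j, a)` with `j < s < n` and `a < s.choose j * 2 ^ (s - j + 1)`. -/
def vertB (n : ℕ) : Finset (ℕ × ℕ × ℕ) :=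
  ((range n).sigma fun s => (range s).sigma fun j => range (s.choose j * 2 ^ (s - j + 1))).map
    sigmaTriple

lemma mem_vertA {n s j a : ℕ} :
    (s, j, a) ∈ vertA n ↔ s < n ∧ (1 ≤ j ∧ j < s) ∧ a < s.choose j := by
  simp only [vertA, mem_map, mem_sigma, mem_range, mem_Ico, sigmaTriple_apply,
    Prod.mk.injEq]
  constructor
  · rintro ⟨⟨s, j, a⟩, h, rfl, rfl, rfl⟩
    exact h
  · exact fun h => ⟨⟨s, j, a⟩, h, rfl, rfl, rfl⟩

lemma mem_vertB {n s j a : ℕ} :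
    (s, j, a) ∈ vertB n ↔ s < n ∧ j < s ∧ a < s.choose j * 2 ^ (s - j + 1) := by
  simp only [vertB, mem_map, mem_sigma, mem_range, sigmaTriple_apply,
    Prod.mk.injEq]
  constructor
  · rintro ⟨⟨s, j, a⟩, h, rfl, rfl, rfl⟩
    exact h
  · exact fun h => ⟨⟨s, j, a⟩, h, rfl, rfl, rfl⟩

/-- Translation of the first two coordinates. -/
def triShift (m : ℕ) : ℕ × ℕ × ℕ ↪ ℕ × ℕ × ℕ where
  toFun x := (x.1 + m, x.2.1 + m, x.2.2)
  inj' := by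
    rintro ⟨a, b, c⟩ ⟨a', b', c'⟩ h
    simp_all

lemma triShift_apply (m : ℕ) (x : ℕ × ℕ × ℕ) :
    triShift m x = (x.1 + m, x.2.1 + m, x.2.2) := rfl

lemma triAdj_symm (x y : ℕ × ℕ × ℕ) (h : TriAdj x y) : TriAdj y x := h.symm

lemma triAdj_triShift (m : ℕ) (x y : ℕ × ℕ × ℕ) :
    TriAdj (triShift m x) (triShift m y) ↔ TriAdj x y := by
  simp [TriAdj, TriLink, triShift_apply, Nat.add_sub_add_right]

lemma choose_sub_sub_le_choose {r k j : ℕ} (hj : j ≤ k) (hk : k ≤ r) :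
    (r - j).choose (k - j) ≤ r.choose k := by
  rw [← Nat.choose_symm (by omega : k - j ≤ r - j), ← Nat.choose_symm hk,
    show r - j - (k - j) = r - k by omega]
  exact Nat.choose_le_choose _ (Nat.sub_le _ _)

lemma mem_map_triShift_vertA {m n r k b : ℕ} :
    (r, k, b) ∈ (vertA n).map (triShift m) ↔
      r < n + m ∧ (m < k ∧ k < r) ∧ b < (r - m).choose (k - m) := by
  simp only [mem_map, triShift_apply, Prod.exists, mem_vertA,
    Prod.mk.injEq]
  constructor
  · rintro ⟨s, j, a, h, rfl, rfl, rfl⟩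
    simp only [Nat.add_sub_cancel]
    omega
  · rintro ⟨h1, h2, h3⟩
    exact ⟨r - m, k - m, b, ⟨by omega, by omega, h3⟩, by omega, by omega, rfl⟩

lemma filter_triAdj_vertA {n j a : ℕ} (hj : j < n) :
    (vertA n).filter (TriAdj (n, j, a)) = vertA j ∪ (vertA (n - j)).map (triShift j) := by
  ext ⟨r, k, b⟩
  rw [mem_filter, mem_union, mem_map_triShift_vertA, mem_vertA, mem_vertA]
  simp only [TriAdj, TriLink]
  constructor
  · rintro ⟨h1, h2 | h2⟩
    · rcases h2.2 with h | h
      · exact Or.inl ⟨h, h1.2⟩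
      · exact Or.inr ⟨by omega, by omega, h.2⟩
    · omega
  · rintro (h | h)
    · exact ⟨⟨by omega, h.2⟩, Or.inl ⟨by omega, Or.inl h.1⟩⟩
    · have := choose_sub_sub_le_choose (r := r) (k := k) (j := j) (by omega) (by omega)
      exact ⟨⟨by omega, by omega, by omega⟩, Or.inl ⟨by omega, Or.inr ⟨by omega, h.2.2⟩⟩⟩

lemma filter_triAdj_vertB {n j a : ℕ} (hj : j < n) :
    (vertB n).filter (TriAdj (n, j, a)) = vertB j ∪ (vertA (n - j)).map (triShift j) := by
  ext ⟨r, k, b⟩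
  rw [mem_filter, mem_union, mem_map_triShift_vertA, mem_vertB, mem_vertB]
  simp only [TriAdj, TriLink]
  constructor
  · rintro ⟨h1, h2 | h2⟩
    · rcases h2.2 with h | h
      · exact Or.inl ⟨h, h1.2⟩
      · exact Or.inr ⟨by omega, by omega, h.2⟩
    · omega
  · rintro (h | h)
    · exact ⟨⟨by omega, h.2⟩, Or.inl ⟨by omega, Or.inl h.1⟩⟩
    · have := choose_sub_sub_le_choose (r := r) (k := k) (j := j) (by omega) (by omega)
      have := Nat.le_mul_of_pos_right (r.choose k) (Nat.two_pow_pos (r - k + 1))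
      exact ⟨⟨by omega, by omega, by omega⟩, Or.inl ⟨by omega, Or.inr ⟨by omega, h.2.2⟩⟩⟩

lemma cliquePoly_link_vertA (n j a : ℕ) (hj : j < n) :
    cliquePoly TriAdj ((vertA n).filter (TriAdj (n, j, a))) =
      cliquePoly TriAdj (vertA j) * cliquePoly TriAdj (vertA (n - j)) := by
  rw [filter_triAdj_vertA hj, cliquePoly_join triAdj_symm,
    cliquePoly_map (triShift j) (triAdj_triShift j)]
  · rw [disjoint_left]
    rintro ⟨r, k, b⟩ h h'
    rw [mem_vertA] at h
    rw [mem_map_triShift_vertA] at h'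
    omega
  · rintro ⟨r, k, b⟩ h ⟨r', k', b'⟩ h'
    rw [mem_vertA] at h
    rw [mem_map_triShift_vertA] at h'
    simp only [TriAdj, TriLink]
    omega

lemma cliquePoly_link_vertB (n j a : ℕ) (hj : j < n) :
    cliquePoly TriAdj ((vertB n).filter (TriAdj (n, j, a))) =
      cliquePoly TriAdj (vertB j) * cliquePoly TriAdj (vertA (n - j)) := by
  rw [filter_triAdj_vertB hj, cliquePoly_join triAdj_symm,
    cliquePoly_map (triShift j) (triAdj_triShift j)]
  · rw [disjoint_left]
    rintro ⟨r, k, b⟩ h h'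
    rw [mem_vertB] at h
    rw [mem_map_triShift_vertA] at h'
    omega
  · rintro ⟨r, k, b⟩ h ⟨r', k', b'⟩ h'
    rw [mem_vertB] at h
    rw [mem_map_triShift_vertA] at h'
    simp only [TriAdj, TriLink]
    omega

/-- Triples with first coordinate `n`. -/
def stageTriple (n : ℕ) : ((_ : ℕ) × ℕ) ↪ ℕ × ℕ × ℕ where
  toFun x := (n, x.1, x.2)
  inj' := by
    rintro ⟨a, b⟩ ⟨a', b'⟩ h
    simp_all

lemma stageTriple_apply (n : ℕ) (x : (_ : ℕ) × ℕ) : stageTriple n x = (n, x.1, x.2) := rfl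

/-- Triples `(n, j, a)` with `j ∈ J` and `a < c j`. -/
def stageVerts (n : ℕ) (J : Finset ℕ) (c : ℕ → ℕ) : Finset (ℕ × ℕ × ℕ) :=
  (J.sigma fun j => range (c j)).map
    (stageTriple n)

lemma mem_stageVerts {n : ℕ} {J : Finset ℕ} {c : ℕ → ℕ} {s j a : ℕ} :
    (s, j, a) ∈ stageVerts n J c ↔ s = n ∧ j ∈ J ∧ a < c j := by
  simp only [stageVerts, mem_map, mem_sigma, mem_range, stageTriple_apply,
    Prod.mk.injEq]
  constructor
  · rintro ⟨⟨j, a⟩, h, rfl, rfl, rfl⟩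
    exact ⟨rfl, h⟩
  · rintro ⟨rfl, h⟩
    exact ⟨⟨j, a⟩, h, rfl, rfl, rfl⟩

lemma cliquePoly_union_stageVerts (V : Finset (ℕ × ℕ × ℕ)) (n : ℕ) (hV : ∀ x ∈ V, x.1 < n)
    (J : Finset ℕ) (c : ℕ → ℕ) (p : ℕ → ℚ[X])
    (hp : ∀ j ∈ J, ∀ a, cliquePoly TriAdj (V.filter (TriAdj (n, j, a))) = p j) :
    cliquePoly TriAdj (V ∪ stageVerts n J c) =
      cliquePoly TriAdj V + X * ∑ j ∈ J, (c j : ℚ[X]) * p j := by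
  rw [cliquePoly_union_indep triAdj_symm]
  · congr 2
    rw [stageVerts, sum_map, sum_sigma]
    refine sum_congr rfl fun j hj => ?_
    have h : ∀ a ∈ range (c j),
        cliquePoly TriAdj (V.filter (TriAdj (stageTriple n ⟨j, a⟩))) = p j :=
      fun a _ => hp j hj a
    rw [sum_congr rfl h]
    simp
  · rw [disjoint_left]
    rintro ⟨r, k, b⟩ h h'
    have := hV _ h
    rw [mem_stageVerts] at h'
    simp only at this
    omega
  · rintro ⟨r, k, b⟩ h ⟨r', k', b'⟩ h'
    rw [mem_stageVerts] at h h'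
    simp only [TriAdj, TriLink]
    omega

lemma cliquePoly_vertA_succ (n : ℕ) :
    cliquePoly TriAdj (vertA (n + 1)) = cliquePoly TriAdj (vertA n) + X * ∑ j ∈ Ico 1 n,
      (n.choose j : ℚ[X]) * (cliquePoly TriAdj (vertA j) * cliquePoly TriAdj (vertA (n - j))) := by
  have : vertA (n + 1) = vertA n ∪ stageVerts n (Ico 1 n) n.choose := by
    ext ⟨s, j, a⟩
    rw [mem_union, mem_vertA, mem_vertA, mem_stageVerts, mem_Ico]
    constructor
    · rintro ⟨h1, h2, h3⟩
      rcases Nat.lt_succ_iff_lt_or_eq.1 h1 with h | rfl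
      · exact Or.inl ⟨h, h2, h3⟩
      · exact Or.inr ⟨rfl, h2, h3⟩
    · rintro (⟨h1, h2, h3⟩ | ⟨rfl, h2, h3⟩)
      · exact ⟨by omega, h2, h3⟩
      · exact ⟨by omega, h2, h3⟩
  rw [this]
  apply cliquePoly_union_stageVerts
  · rintro ⟨s, j, a⟩ h
    exact (mem_vertA.1 h).1
  · exact fun j hj a => cliquePoly_link_vertA n j a (mem_Ico.1 hj).2

lemma cliquePoly_vertB_succ (n : ℕ) :
    cliquePoly TriAdj (vertB (n + 1)) = cliquePoly TriAdj (vertB n) + X * ∑ j ∈ range n,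
      ((n.choose j * 2 ^ (n - j + 1) : ℕ) : ℚ[X]) *
        (cliquePoly TriAdj (vertB j) * cliquePoly TriAdj (vertA (n - j))) := by
  have : vertB (n + 1) =
      vertB n ∪ stageVerts n (range n) fun j => n.choose j * 2 ^ (n - j + 1) := by
    ext ⟨s, j, a⟩
    rw [mem_union, mem_vertB, mem_vertB, mem_stageVerts, mem_range]
    constructor
    · rintro ⟨h1, h2, h3⟩
      rcases Nat.lt_succ_iff_lt_or_eq.1 h1 with h | rfl
      · exact Or.inl ⟨h, h2, h3⟩
      · exact Or.inr ⟨rfl, h2, h3⟩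
    · rintro (⟨h1, h2, h3⟩ | ⟨rfl, h2, h3⟩)
      · exact ⟨by omega, h2, h3⟩
      · exact ⟨by omega, h2, h3⟩
  rw [this]
  apply cliquePoly_union_stageVerts
  · rintro ⟨s, j, a⟩ h
    exact (mem_vertB.1 h).1
  · exact fun j hj a => cliquePoly_link_vertB n j a (mem_range.1 hj)

section Insertion

variable {n : ℕ}

/-- Insert the largest value into the word of `w` at position `p`. -/
def insertMax (p : Fin (n + 1)) (w : Equiv.Perm (Fin n)) : Equiv.Perm (Fin (n + 1)) :=
  (finSuccEquiv' p).trans ((Equiv.optionCongr w).trans (finSuccEquiv' (Fin.last n)).symm)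

lemma insertMax_self (p : Fin (n + 1)) (w : Equiv.Perm (Fin n)) :
    insertMax p w p = Fin.last n := by
  simp [insertMax]

lemma insertMax_succAbove (p : Fin (n + 1)) (w : Equiv.Perm (Fin n)) (i : Fin n) :
    insertMax p w (p.succAbove i) = (w i).castSucc := by
  simp [insertMax]

lemma insertMax_bijective :
    Function.Bijective fun x : Fin (n + 1) × Equiv.Perm (Fin n) => insertMax x.1 x.2 := by
  rw [Fintype.bijective_iff_injective_and_card]
  refine ⟨?_, by simp [Fintype.card_perm, Nat.factorial_succ]⟩
  rintro ⟨p, w⟩ ⟨q, u⟩ h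
  simp only at h
  have hpq : p = q := by
    apply (insertMax q u).injective
    rw [insertMax_self, ← h, insertMax_self]
  subst hpq
  refine Prod.ext rfl (Equiv.ext fun i => ?_)
  have := insertMax_succAbove p w i
  rw [h, insertMax_succAbove] at this
  exact (Fin.castSucc_injective n this).symm

lemma pval_le (w : Equiv.Perm (Fin n)) (i : ℕ) : pval n w i ≤ n := by
  unfold pval
  split_ifs with h
  · have := (w ⟨i - 1, by omega⟩).isLt
    omega
  · omega

lemma pval_insertMax_self (p : Fin (n + 1)) (w : Equiv.Perm (Fin n)) :
    pval (n + 1) (insertMax p w) (p + 1) = n + 1 := by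
  unfold pval
  rw [dif_pos (by omega)]
  simp only [Nat.add_sub_cancel, Fin.eta, insertMax_self, Fin.val_last]

lemma pval_insertMax_of_le (p : Fin (n + 1)) (w : Equiv.Perm (Fin n)) {i : ℕ} (hi : i ≤ p) :
    pval (n + 1) (insertMax p w) i = pval n w i := by
  unfold pval
  by_cases h : 1 ≤ i
  · have hidx : (⟨i - 1, by omega⟩ : Fin (n + 1)) = p.succAbove ⟨i - 1, by omega⟩ := by
      rw [Fin.succAbove_of_castSucc_lt]
      · rfl
      · rw [Fin.lt_def]
        simp only [Fin.val_castSucc]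
        omega
    rw [dif_pos (by omega), dif_pos (by omega), hidx, insertMax_succAbove]
    rfl
  · rw [dif_neg (by omega), dif_neg (by omega)]

lemma pval_insertMax_succ_of_lt (p : Fin (n + 1)) (w : Equiv.Perm (Fin n)) {i : ℕ} (hi : p < i) :
    pval (n + 1) (insertMax p w) (i + 1) = pval n w i := by
  unfold pval
  by_cases h : i ≤ n
  · have hidx : (⟨i + 1 - 1, by omega⟩ : Fin (n + 1)) = p.succAbove ⟨i - 1, by omega⟩ := by
      rw [Fin.succAbove_of_le_castSucc]
      · ext
        simp only [Fin.val_succ]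
        omega
      · rw [Fin.le_def]
        simp only [Fin.val_castSucc]
        omega
    rw [dif_pos (by omega), dif_pos (by omega), hidx, insertMax_succAbove]
    rfl
  · rw [dif_neg (by omega), dif_neg (by omega)]

lemma mem_pkSet {w : Equiv.Perm (Fin n)} {i : ℕ} :
    i ∈ pkSet n w ↔ (1 ≤ i ∧ i ≤ n - 1) ∧
      pval n w (i - 1) < pval n w i ∧ pval n w (i + 1) < pval n w i := by
  simp [pkSet]

lemma succ_notMem_pkSet {w : Equiv.Perm (Fin n)} {i : ℕ} (hi : i ∈ pkSet n w) :
    i + 1 ∉ pkSet n w := by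
  rw [mem_pkSet] at hi ⊢
  rw [show i + 1 - 1 = i from rfl]
  omega

/-- The order embedding of `ℕ` skipping the value `q`. -/
def skipEmb (q : ℕ) : ℕ ↪ ℕ where
  toFun i := if i < q then i else i + 1
  inj' := by
    intro a b h
    simp only at h
    split_ifs at h <;> omega

lemma skipEmb_apply (q i : ℕ) : skipEmb q i = if i < q then i else i + 1 := rfl

lemma pkSet_insertMax (p : Fin (n + 1)) (w : Equiv.Perm (Fin n)) :
    pkSet (n + 1) (insertMax p w) =
      (((pkSet n w).erase p).erase (p + 1)).map (skipEmb (p + 1)) ∪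
        (if (p : ℕ) < n then {(p : ℕ) + 1} else ∅) := by
  have hself := pval_insertMax_self p w
  have hle : ∀ i, pval n w i ≤ n := pval_le w
  have hp := p.isLt
  ext i
  have hsing : i ∈ (if (p : ℕ) < n then {(p : ℕ) + 1} else ∅ : Finset ℕ) ↔
      (p : ℕ) < n ∧ i = p + 1 := by
    split_ifs with h <;> simp [h]
  rw [mem_union, hsing, mem_map, mem_pkSet]
  simp only [mem_erase, skipEmb_apply]
  rcases lt_trichotomy i (p + 1) with h | h | h
  · have h1 := pval_insertMax_of_le p w (i := i - 1) (by omega)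
    have h2 := pval_insertMax_of_le p w (i := i) (by omega)
    rw [h1, h2]
    constructor
    · rintro ⟨h3, h4, h5⟩
      have hip : i ≠ p := by
        rintro rfl
        have := hle (p : ℕ)
        omega
      rw [pval_insertMax_of_le p w (i := i + 1) (by omega)] at h5
      exact Or.inl ⟨i, ⟨by omega, hip, mem_pkSet.2 ⟨by omega, h4, h5⟩⟩, by simp [h]⟩
    · rintro (⟨j, ⟨h3, h4, h5⟩, h6⟩ | h3)
      · have hj : j = i := by split_ifs at h6 <;> omega
        subst hj
        rw [mem_pkSet] at h5
        rw [pval_insertMax_of_le p w (i := j + 1) (by omega)]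
        exact ⟨by omega, h5.2⟩
      · omega
  · subst h
    have h1 := pval_insertMax_of_le p w (i := p) le_rfl
    have h2 := pval_insertMax_succ_of_lt p w (i := p + 1) (by omega)
    have h3 := hle p
    have h4 := hle (p + 1)
    rw [show (p : ℕ) + 1 - 1 = p from rfl, hself, h1, h2]
    constructor
    · intro h
      right
      omega
    · rintro (⟨j, -, h6⟩ | h)
      · split_ifs at h6 <;> omega
      · omega
  · obtain ⟨k, rfl⟩ : ∃ k, i = k + 1 := ⟨i - 1, by omega⟩
    have h1 := pval_insertMax_succ_of_lt p w (i := k) (by omega)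
    have h2 := pval_insertMax_succ_of_lt p w (i := k + 1) (by omega)
    rw [show k + 1 - 1 = k from rfl, h1, h2]
    constructor
    · rintro ⟨h3, h4, h5⟩
      have hk : k ≠ p + 1 := by
        rintro rfl
        have := hle (p + 1)
        omega
      have h6 := pval_insertMax_succ_of_lt p w (i := k - 1) (by omega)
      rw [show k - 1 + 1 = k by omega] at h6
      rw [h6] at h4
      have hkn : k ≤ n - 1 := by omega
      exact Or.inl ⟨k, ⟨hk, by omega, mem_pkSet.2 ⟨by omega, h4, h5⟩⟩, by
        rw [if_neg (by omega)]⟩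
    · rintro (⟨j, ⟨h3, h4, h5⟩, h6⟩ | h3)
      · have hj : j = k := by split_ifs at h6 <;> omega
        subst hj
        have h7 := pval_insertMax_succ_of_lt p w (i := j - 1) (by omega)
        rw [mem_pkSet] at h5
        rw [show j - 1 + 1 = j by omega] at h7
        rw [h7]
        exact ⟨by omega, h5.2⟩
      · omega

lemma pk_insertMax (p : Fin (n + 1)) (w : Equiv.Perm (Fin n)) :
    pk (n + 1) (insertMax p w) =
      if (p : ℕ) < n ∧ ¬ ((p : ℕ) ∈ pkSet n w ∨ (p : ℕ) + 1 ∈ pkSet n w) then pk n w + 1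
      else pk n w := by
  have hp := p.isLt
  have hdisj : Disjoint ((((pkSet n w).erase p).erase (p + 1)).map (skipEmb (p + 1)))
      (if (p : ℕ) < n then {(p : ℕ) + 1} else ∅) := by
    split_ifs
    · rw [disjoint_singleton_right, mem_map]
      rintro ⟨j, -, hj⟩
      simp only [skipEmb_apply] at hj
      split_ifs at hj <;> omega
    · simp
  rw [pk, pkSet_insertMax, card_union_of_disjoint hdisj, card_map, pk]
  have hlast : (p : ℕ) ∈ pkSet n w ∨ (p : ℕ) + 1 ∈ pkSet n w → (p : ℕ) < n := by
    rw [mem_pkSet, mem_pkSet]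
    omega
  by_cases h1 : (p : ℕ) ∈ pkSet n w
  · have h2 : (p : ℕ) + 1 ∉ pkSet n w := succ_notMem_pkSet h1
    have h3 := hlast (Or.inl h1)
    rw [erase_eq_of_notMem fun h => h2 (mem_of_mem_erase h), card_erase_of_mem h1]
    have := card_pos.2 ⟨_, h1⟩
    simp only [h1, h3, true_or, not_true, and_false, if_true, if_false, card_singleton]
    omega
  · rw [erase_eq_of_notMem h1]
    by_cases h2 : (p : ℕ) + 1 ∈ pkSet n w
    · have h3 := hlast (Or.inr h2)
      rw [card_erase_of_mem h2]
      have := card_pos.2 ⟨_, h2⟩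
      simp only [h2, h3, or_true, not_true, and_false, if_true, if_false, card_singleton]
      omega
    · rw [erase_eq_of_notMem h2]
      by_cases h3 : (p : ℕ) < n <;> simp [h1, h2, h3]

lemma card_filter_mem_pkSet (w : Equiv.Perm (Fin n)) :
    ((range n).filter fun p => p ∈ pkSet n w ∨ p + 1 ∈ pkSet n w).card = 2 * pk n w := by
  have hS : ∀ i ∈ pkSet n w, 1 ≤ i ∧ i ≤ n - 1 := fun i hi => (mem_pkSet.1 hi).1
  have h : ((range n).filter fun p => p ∈ pkSet n w ∨ p + 1 ∈ pkSet n w) =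
      pkSet n w ∪ (pkSet n w).image (fun i => i - 1) := by
    ext i
    simp only [mem_filter, mem_range, mem_union, mem_image]
    constructor
    · rintro ⟨-, h | h⟩
      · exact Or.inl h
      · exact Or.inr ⟨i + 1, h, rfl⟩
    · rintro (h | ⟨j, h, rfl⟩)
      · have := hS i h
        exact ⟨by omega, Or.inl h⟩
      · have := hS j h
        refine ⟨by omega, Or.inr ?_⟩
        rwa [show j - 1 + 1 = j by omega]
  rw [h, card_union_of_disjoint, card_image_of_injOn, pk, two_mul]
  · intro a ha b hb hab
    have := hS a ha
    have := hS b hb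
    simp only at hab
    omega
  · rw [disjoint_left]
    intro a ha h
    obtain ⟨j, hj, rfl⟩ := mem_image.1 h
    have := hS j hj
    apply succ_notMem_pkSet ha
    rwa [show j - 1 + 1 = j by omega]

lemma sum_pow_pk_insertMax {R : Type*} [CommRing R] (x : R) (w : Equiv.Perm (Fin n)) :
    ∑ p : Fin (n + 1), x ^ pk (n + 1) (insertMax p w) =
      (2 * (pk n w : R) + 1) * x ^ pk n w + ((n : R) - 2 * pk n w) * x ^ (pk n w + 1) := by
  have hc := card_filter_mem_pkSet w
  have hc' := card_filter_add_card_filter_not (s := range n)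
    (fun p => p ∈ pkSet n w ∨ p + 1 ∈ pkSet n w)
  rw [card_range, hc] at hc'
  have hc'' : (((range n).filter fun p => ¬ (p ∈ pkSet n w ∨ p + 1 ∈ pkSet n w)).card : R) =
      n - 2 * pk n w := by
    have h := congrArg (Nat.cast : ℕ → R) hc'
    rw [Nat.cast_add, Nat.cast_mul, Nat.cast_ofNat] at h
    rw [eq_sub_iff_add_eq']
    convert h
  simp only [pk_insertMax]
  rw [Fin.sum_univ_castSucc]
  simp only [Fin.val_castSucc, Fin.is_lt, true_and, Fin.val_last, lt_irrefl, false_and, if_false]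
  rw [Fin.sum_univ_eq_sum_range fun p => x ^
    (if ¬ (p ∈ pkSet n w ∨ p + 1 ∈ pkSet n w) then pk n w + 1 else pk n w)]
  simp only [ite_not, apply_ite (x ^ ·)]
  rw [sum_ite, sum_const, sum_const, hc, nsmul_eq_mul, nsmul_eq_mul, hc'']
  push_cast
  ring

end Insertion

/-- The generating polynomial of `4 ^ pk(0w)` over `w ∈ S_n`, by the number of peaks. -/
noncomputable def peakPoly (n : ℕ) : ℚ[X] := ∑ w : Equiv.Perm (Fin n), (4 * X) ^ pk n w

lemma peakPoly_zero : peakPoly 0 = 1 := by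
  simp [peakPoly, pk, pkSet]

lemma X_mul_derivative_peakPoly (n : ℕ) :
    X * derivative (peakPoly n) =
      ∑ w : Equiv.Perm (Fin n), (pk n w : ℚ[X]) * (4 * X) ^ pk n w := by
  rw [peakPoly, derivative_sum, mul_sum]
  refine sum_congr rfl fun w _ => ?_
  rcases pk n w with _ | k
  · simp
  · rw [derivative_pow, show (4 * X : ℚ[X]) = C 4 * X by rw [map_ofNat], derivative_C_mul,
      derivative_X, Nat.add_sub_cancel, map_natCast]
    ring

lemma peakPoly_succ (n : ℕ) :
    peakPoly (n + 1) = (1 + 4 * (n : ℚ[X]) * X) * peakPoly n +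
      2 * X * (1 - 4 * X) * derivative (peakPoly n) := by
  have h : peakPoly (n + 1) = ∑ w : Equiv.Perm (Fin n), ∑ p : Fin (n + 1),
      (4 * X : ℚ[X]) ^ pk (n + 1) (insertMax p w) := by
    rw [peakPoly, ← insertMax_bijective.sum_comp, Fintype.sum_prod_type, sum_comm]
  have h2 : 2 * X * (1 - 4 * X) * derivative (peakPoly n) =
      2 * (1 - 4 * X) * (X * derivative (peakPoly n)) := by ring
  rw [h, h2, X_mul_derivative_peakPoly, peakPoly, mul_sum, mul_sum, ← sum_add_distrib]
  refine sum_congr rfl fun w _ => ?_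
  rw [sum_pow_pk_insertMax]
  ring

lemma coeff_peakPoly (n i : ℕ) :
    (peakPoly n).coeff i =
      4 ^ i * ((univ.filter fun w : Equiv.Perm (Fin n) => pk n w = i).card : ℚ) := by
  rw [peakPoly, finsetSum_coeff, card_filter, Nat.cast_sum, mul_sum]
  refine sum_congr rfl fun w _ => ?_
  rw [show (4 * X : ℚ[X]) = C 4 * X by rw [map_ofNat], mul_pow, ← C_pow, coeff_C_mul, coeff_X_pow]
  by_cases h : i = pk n w
  · simp [h]
  · simp [h, Ne.symm h]

section GeneratingFunction

/-- The exponential generating function of a sequence of polynomials. -/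
noncomputable def egf (a : ℕ → ℚ[X]) : PowerSeries ℚ[X] :=
  PowerSeries.mk fun n => C ((n.factorial : ℚ)⁻¹) * a n

/-- Apply the derivative of polynomials to each coefficient of a power series. -/
noncomputable def coeffDeriv (f : PowerSeries ℚ[X]) : PowerSeries ℚ[X] :=
  PowerSeries.mk fun n => derivative (PowerSeries.coeff n f)

/-- The binomial convolution of two sequences. -/
noncomputable def binomConv (a b : ℕ → ℚ[X]) (n : ℕ) : ℚ[X] :=
  ∑ j ∈ range (n + 1), (n.choose j : ℚ[X]) * (a j * b (n - j))

lemma coeff_egf (a : ℕ → ℚ[X]) (n : ℕ) :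
    PowerSeries.coeff n (egf a) = C ((n.factorial : ℚ)⁻¹) * a n := by
  simp [egf]

lemma coeff_coeffDeriv (f : PowerSeries ℚ[X]) (n : ℕ) :
    PowerSeries.coeff n (coeffDeriv f) = derivative (PowerSeries.coeff n f) := by
  simp [coeffDeriv]

lemma egf_injective : Function.Injective egf := by
  intro a b h
  funext n
  have := congrArg (PowerSeries.coeff n) h
  rw [coeff_egf, coeff_egf] at this
  refine mul_left_cancel₀ ?_ this
  rw [Ne, C_eq_zero, inv_eq_zero, Nat.cast_eq_zero]
  exact n.factorial_ne_zero

lemma egf_add (a b : ℕ → ℚ[X]) : egf (fun n => a n + b n) = egf a + egf b := by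
  ext1 n
  simp [coeff_egf, mul_add]

lemma egf_const_mul (p : ℚ[X]) (a : ℕ → ℚ[X]) :
    egf (fun n => p * a n) = PowerSeries.C p * egf a := by
  ext1 n
  rw [PowerSeries.coeff_C_mul, coeff_egf, coeff_egf]
  ring

lemma egf_single_zero : egf (fun n => if n = 0 then 1 else 0) = 1 := by
  ext1 n
  rw [coeff_egf, PowerSeries.coeff_one]
  split_ifs with h <;> simp [h]

lemma C_inv_factorial_succ (n : ℕ) :
    (C (((n + 1).factorial : ℚ)⁻¹) : ℚ[X]) * ((n : ℚ[X]) + 1) = C ((n.factorial : ℚ)⁻¹) := by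
  rw [show (n : ℚ[X]) + 1 = C ((n : ℚ) + 1) by simp, ← C_mul, Nat.factorial_succ]
  congr 1
  have : (n.factorial : ℚ) ≠ 0 := Nat.cast_ne_zero.2 n.factorial_ne_zero
  push_cast
  field_simp

lemma derivative_egf (a : ℕ → ℚ[X]) :
    PowerSeries.derivative ℚ[X] (egf a) = egf fun n => a (n + 1) := by
  ext1 n
  rw [PowerSeries.coeff_derivative, coeff_egf, coeff_egf, mul_right_comm, C_inv_factorial_succ]

lemma X_mul_derivative_egf (a : ℕ → ℚ[X]) :
    PowerSeries.X * PowerSeries.derivative ℚ[X] (egf a) = egf fun n => (n : ℚ[X]) * a n := by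
  ext1 n
  rcases n with _ | n
  · simp [coeff_egf]
  · rw [PowerSeries.coeff_succ_X_mul, PowerSeries.coeff_derivative, coeff_egf, coeff_egf]
    push_cast
    ring

lemma coeffDeriv_egf (a : ℕ → ℚ[X]) :
    coeffDeriv (egf a) = egf fun n => derivative (a n) := by
  ext1 n
  rw [coeff_coeffDeriv, coeff_egf, coeff_egf, derivative_C_mul]

lemma egf_mul (a b : ℕ → ℚ[X]) : egf a * egf b = egf (binomConv a b) := by
  ext1 n
  rw [PowerSeries.coeff_mul, coeff_egf, binomConv, mul_sum,
    Nat.sum_antidiagonal_eq_sum_range_succ_mk]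
  refine sum_congr rfl fun j hj => ?_
  have hj' : j ≤ n := Nat.lt_succ_iff.1 (mem_range.1 hj)
  have h : (C ((j.factorial : ℚ)⁻¹) : ℚ[X]) * C (((n - j).factorial : ℚ)⁻¹) =
      C ((n.factorial : ℚ)⁻¹) * (n.choose j : ℚ[X]) := by
    rw [← C_mul, ← map_natCast (C : ℚ →+* ℚ[X]), ← C_mul]
    congr 1
    have h1 := Nat.choose_mul_factorial_mul_factorial hj'
    have h2 : (n.choose j : ℚ) * j.factorial * (n - j).factorial = n.factorial := by
      exact_mod_cast h1
    have h3 : (j.factorial : ℚ) ≠ 0 := Nat.cast_ne_zero.2 j.factorial_ne_zero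
    have h4 : ((n - j).factorial : ℚ) ≠ 0 := Nat.cast_ne_zero.2 (n - j).factorial_ne_zero
    have h5 : (n.factorial : ℚ) ≠ 0 := Nat.cast_ne_zero.2 n.factorial_ne_zero
    field_simp
    linear_combination -h2
  simp only [coeff_egf]
  linear_combination a j * b (n - j) * h

lemma coeffDeriv_add (f g : PowerSeries ℚ[X]) :
    coeffDeriv (f + g) = coeffDeriv f + coeffDeriv g := by
  ext1 n
  simp [coeff_coeffDeriv]

lemma coeffDeriv_mul (f g : PowerSeries ℚ[X]) :
    coeffDeriv (f * g) = coeffDeriv f * g + f * coeffDeriv g := by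
  ext1 n
  simp only [coeff_coeffDeriv, PowerSeries.coeff_mul, map_add, derivative_sum, derivative_mul,
    sum_add_distrib]

lemma coeffDeriv_C (p : ℚ[X]) :
    coeffDeriv (PowerSeries.C p) = PowerSeries.C (derivative p) := by
  ext1 n
  rw [coeff_coeffDeriv, PowerSeries.coeff_C, PowerSeries.coeff_C]
  split_ifs <;> simp

lemma coeffDeriv_natCast (k : ℕ) : coeffDeriv (k : PowerSeries ℚ[X]) = 0 := by
  rw [← map_natCast (PowerSeries.C : ℚ[X] →+* PowerSeries ℚ[X]), coeffDeriv_C]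
  simp

lemma derivative_natCast_powerSeries (k : ℕ) :
    PowerSeries.derivative ℚ[X] (k : PowerSeries ℚ[X]) = 0 := by
  rw [← map_natCast (PowerSeries.C : ℚ[X] →+* PowerSeries ℚ[X]), PowerSeries.derivative_C]

lemma derivative_coeffDeriv (f : PowerSeries ℚ[X]) :
    PowerSeries.derivative ℚ[X] (coeffDeriv f) = coeffDeriv (PowerSeries.derivative ℚ[X] f) := by
  ext1 n
  rw [PowerSeries.coeff_derivative, coeff_coeffDeriv, coeff_coeffDeriv,
    PowerSeries.coeff_derivative, derivative_mul]
  simp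

lemma eq_zero_of_derivative_eq_mul {Y H : PowerSeries ℚ[X]} (h0 : PowerSeries.coeff 0 Y = 0)
    (h : PowerSeries.derivative ℚ[X] Y = H * Y) : Y = 0 := by
  ext1 n
  induction n using Nat.strong_induction_on with
  | _ n ih =>
    rcases n with _ | n
    · simpa using h0
    · have h1 := congrArg (PowerSeries.coeff n) h
      rw [PowerSeries.coeff_derivative, PowerSeries.coeff_mul, sum_eq_zero] at h1
      · have h2 : ((n : ℚ[X]) + 1) ≠ 0 := by exact_mod_cast Nat.succ_ne_zero n
        simpa using (mul_eq_zero.1 h1).resolve_right h2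
      · intro x hx
        have : x.2 < n + 1 := by
          have := mem_antidiagonal.1 hx
          omega
        rw [ih _ this]
        simp

/-- The first-order differential operator `(1 - 4tz) ∂/∂z - 2t(1 - 4t) ∂/∂t`. -/
noncomputable def peakOp (f : PowerSeries ℚ[X]) : PowerSeries ℚ[X] :=
  (1 - 4 * PowerSeries.C X * PowerSeries.X) * PowerSeries.derivative ℚ[X] f -
    2 * PowerSeries.C X * (1 - 4 * PowerSeries.C X) * coeffDeriv f

lemma derivative_peakOp (f : PowerSeries ℚ[X]) :
    PowerSeries.derivative ℚ[X] (peakOp f) =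
      peakOp (PowerSeries.derivative ℚ[X] f) -
        4 * PowerSeries.C X * PowerSeries.derivative ℚ[X] f := by
  have h4 : PowerSeries.derivative ℚ[X] (4 : PowerSeries ℚ[X]) = 0 := by
    exact_mod_cast derivative_natCast_powerSeries 4
  have h2 : PowerSeries.derivative ℚ[X] (2 : PowerSeries ℚ[X]) = 0 := by
    exact_mod_cast derivative_natCast_powerSeries 2
  simp only [peakOp, map_sub, Derivation.leibniz, smul_eq_mul, PowerSeries.derivative_C,
    PowerSeries.derivative_X, Derivation.map_one_eq_zero, h4, h2, derivative_coeffDeriv]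
  ring

lemma peakOp_mul (f g : PowerSeries ℚ[X]) : peakOp (f * g) = peakOp f * g + f * peakOp g := by
  simp only [peakOp, Derivation.leibniz, smul_eq_mul, coeffDeriv_mul]
  ring

lemma peakOp_add (f g : PowerSeries ℚ[X]) : peakOp (f + g) = peakOp f + peakOp g := by
  simp only [peakOp, map_add, coeffDeriv_add]
  ring

lemma peakOp_natCast (k : ℕ) : peakOp (k : PowerSeries ℚ[X]) = 0 := by
  rw [peakOp, coeffDeriv_natCast, derivative_natCast_powerSeries]
  ring

lemma peakOp_C_X : peakOp (PowerSeries.C X) =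
    - (2 * PowerSeries.C X * (1 - 4 * PowerSeries.C X)) := by
  rw [peakOp, coeffDeriv_C, PowerSeries.derivative_C, derivative_X, map_one]
  ring

lemma peakOp_of_riccati {G : PowerSeries ℚ[X]} (h0 : PowerSeries.coeff 0 G = 0)
    (hG : PowerSeries.derivative ℚ[X] G = 1 + 2 * G + 4 * PowerSeries.C X * (G * G)) :
    peakOp G = (2 - 4 * PowerSeries.C X) * G + 1 := by
  have h1 : peakOp (1 : PowerSeries ℚ[X]) = 0 := by exact_mod_cast peakOp_natCast 1
  have h2 : peakOp (2 : PowerSeries ℚ[X]) = 0 := by exact_mod_cast peakOp_natCast 2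
  have h4 : peakOp (4 : PowerSeries ℚ[X]) = 0 := by exact_mod_cast peakOp_natCast 4
  have d4 : PowerSeries.derivative ℚ[X] (4 : PowerSeries ℚ[X]) = 0 := by
    exact_mod_cast derivative_natCast_powerSeries 4
  have d2 : PowerSeries.derivative ℚ[X] (2 : PowerSeries ℚ[X]) = 0 := by
    exact_mod_cast derivative_natCast_powerSeries 2
  have hD := congrArg peakOp hG
  simp only [peakOp_add, peakOp_mul, h1, h2, h4, peakOp_C_X] at hD
  rw [← sub_eq_zero]
  apply eq_zero_of_derivative_eq_mul (H := 2 + 8 * PowerSeries.C X * G)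
  · have hG0 : PowerSeries.coeff 0 (PowerSeries.derivative ℚ[X] G) = 1 := by
      rw [hG]
      simp only [PowerSeries.coeff_zero_eq_constantCoeff] at h0 ⊢
      simp [h0]
    have hc : PowerSeries.coeff 0 (coeffDeriv G) = 0 := by
      rw [coeff_coeffDeriv, h0, derivative_zero]
    simp only [peakOp, PowerSeries.coeff_zero_eq_constantCoeff] at h0 hG0 hc ⊢
    simp [h0, hG0, hc]
  · simp only [map_sub, map_add, Derivation.leibniz, smul_eq_mul, PowerSeries.derivative_C,
      Derivation.map_one_eq_zero, d4, d2, derivative_peakOp]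
    linear_combination hD - 2 * hG

lemma peakOp_of_linear {F G : PowerSeries ℚ[X]} (hF0 : PowerSeries.coeff 0 F = 1)
    (hG0 : PowerSeries.coeff 0 G = 0)
    (hG : peakOp G = (2 - 4 * PowerSeries.C X) * G + 1)
    (hF : PowerSeries.derivative ℚ[X] F = F + 4 * PowerSeries.C X * (F * G)) :
    peakOp F = F := by
  have h4 : peakOp (4 : PowerSeries ℚ[X]) = 0 := by exact_mod_cast peakOp_natCast 4
  have hD := congrArg peakOp hF
  simp only [peakOp_add, peakOp_mul, h4, peakOp_C_X] at hD
  rw [← sub_eq_zero]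
  apply eq_zero_of_derivative_eq_mul (H := 1 + 4 * PowerSeries.C X * G)
  · have hF1 : PowerSeries.coeff 0 (PowerSeries.derivative ℚ[X] F) = 1 := by
      rw [hF]
      simp only [PowerSeries.coeff_zero_eq_constantCoeff] at hF0 hG0 ⊢
      simp [hF0, hG0]
    have hc : PowerSeries.coeff 0 (coeffDeriv F) = 0 := by
      rw [coeff_coeffDeriv, hF0, derivative_one]
    simp only [peakOp, PowerSeries.coeff_zero_eq_constantCoeff] at hF0 hF1 hc ⊢
    simp [hF0, hF1, hc]
  · simp only [map_sub, derivative_peakOp]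
    linear_combination hD + 4 * PowerSeries.C X * F * hG - (1 + 4 * PowerSeries.C X) * hF

lemma succ_of_binomConv {b g : ℕ → ℚ[X]} (hb0 : b 0 = 1) (hg0 : g 0 = 0)
    (hg : ∀ n, g (n + 1) = (if n = 0 then 1 else 0) + 2 * g n + 4 * X * binomConv g g n)
    (hb : ∀ n, b (n + 1) = b n + 4 * X * binomConv b g n) (n : ℕ) :
    b (n + 1) = (1 + 4 * (n : ℚ[X]) * X) * b n + 2 * X * (1 - 4 * X) * derivative (b n) := by
  have hC2 : (PowerSeries.C (2 : ℚ[X])) = 2 := map_ofNat _ 2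
  have hC4 : (PowerSeries.C (4 : ℚ[X])) = 4 := map_ofNat _ 4
  have hG0 : PowerSeries.coeff 0 (egf g) = 0 := by rw [coeff_egf, hg0, mul_zero]
  have hB0 : PowerSeries.coeff 0 (egf b) = 1 := by simp [coeff_egf, hb0]
  have hG : PowerSeries.derivative ℚ[X] (egf g) =
      1 + 2 * egf g + 4 * PowerSeries.C X * (egf g * egf g) := by
    rw [derivative_egf, funext hg, egf_add, egf_add, egf_single_zero, egf_const_mul,
      egf_const_mul, egf_mul, map_mul, hC2, hC4]
  have hB : PowerSeries.derivative ℚ[X] (egf b) =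
      egf b + 4 * PowerSeries.C X * (egf b * egf g) := by
    rw [derivative_egf, funext hb, egf_add, egf_const_mul, egf_mul, map_mul, hC4]
  have h := peakOp_of_linear hB0 hG0 (peakOp_of_riccati hG0 hG) hB
  have h' : egf (fun n => b (n + 1)) = egf fun n => (b n + (4 * X) * ((n : ℚ[X]) * b n)) +
      (2 * X * (1 - 4 * X)) * derivative (b n) := by
    rw [egf_add, egf_add, egf_const_mul, egf_const_mul, ← X_mul_derivative_egf,
      ← coeffDeriv_egf, ← derivative_egf]
    simp only [map_mul, map_sub, map_one, hC2, hC4]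
    rw [peakOp] at h
    linear_combination h
  rw [congrFun (egf_injective h') n]
  ring

end GeneratingFunction

/-- Rescaled clique polynomials of `vertA`. -/
noncomputable def scaledPolyA (n : ℕ) : ℚ[X] :=
  if n = 0 then 0 else 2 ^ (n - 1) * cliquePoly TriAdj (vertA n)

lemma scaledPolyA_zero : scaledPolyA 0 = 0 := if_pos rfl

lemma scaledPolyA_of_pos {n : ℕ} (hn : 0 < n) :
    scaledPolyA n = 2 ^ (n - 1) * cliquePoly TriAdj (vertA n) := if_neg hn.ne'

lemma scaledPolyA_succ (n : ℕ) :
    scaledPolyA (n + 1) = (if n = 0 then 1 else 0) + 2 * scaledPolyA n +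
      4 * X * binomConv scaledPolyA scaledPolyA n := by
  rcases n with _ | n
  · have : vertA 0 = ∅ := by simp [vertA]
    rw [scaledPolyA_of_pos (Nat.succ_pos 0), cliquePoly_vertA_succ, this, cliquePoly_empty]
    simp [scaledPolyA_zero, binomConv]
  · have hconv : 4 * binomConv scaledPolyA scaledPolyA (n + 1) =
        2 ^ (n + 1) * ∑ j ∈ Ico 1 (n + 1), ((n + 1).choose j : ℚ[X]) *
          (cliquePoly TriAdj (vertA j) * cliquePoly TriAdj (vertA (n + 1 - j))) := by
      have hsub : Ico 1 (n + 1) ⊆ range (n + 1 + 1) := fun j hj => by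
        rw [mem_Ico] at hj
        rw [mem_range]
        omega
      rw [binomConv, ← sum_subset hsub, mul_sum, mul_sum]
      · refine sum_congr rfl fun j hj => ?_
        rw [mem_Ico] at hj
        obtain ⟨i, rfl⟩ : ∃ i, j = i + 1 := ⟨j - 1, by omega⟩
        obtain ⟨k, rfl⟩ : ∃ k, n = i + 1 + k := ⟨n - (i + 1), by omega⟩
        rw [show i + 1 + k + 1 - (i + 1) = k + 1 by omega, scaledPolyA_of_pos (by omega),
          scaledPolyA_of_pos (by omega), Nat.add_sub_cancel, Nat.add_sub_cancel]
        ring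
      · intro j hj hj'
        rw [mem_range] at hj
        rw [mem_Ico] at hj'
        have : j = 0 ∨ n + 1 - j = 0 := by omega
        rcases this with h | h <;> simp [h, scaledPolyA_zero]
    rw [mul_right_comm, hconv, scaledPolyA_of_pos (by omega), scaledPolyA_of_pos (by omega),
      cliquePoly_vertA_succ, if_neg (by omega), Nat.add_sub_cancel, Nat.add_sub_cancel]
    ring

lemma cliquePoly_vertB_succ_eq_binomConv (n : ℕ) :
    cliquePoly TriAdj (vertB (n + 1)) = cliquePoly TriAdj (vertB n) +
      4 * X * binomConv (fun k => cliquePoly TriAdj (vertB k)) scaledPolyA n := by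
  have h : 4 * binomConv (fun k => cliquePoly TriAdj (vertB k)) scaledPolyA n =
      ∑ j ∈ range n, ((n.choose j * 2 ^ (n - j + 1) : ℕ) : ℚ[X]) *
        (cliquePoly TriAdj (vertB j) * cliquePoly TriAdj (vertA (n - j))) := by
    rw [binomConv, sum_range_succ, Nat.sub_self, scaledPolyA_zero, mul_zero, mul_zero, add_zero,
      mul_sum]
    refine sum_congr rfl fun j hj => ?_
    rw [mem_range] at hj
    obtain ⟨k, rfl⟩ : ∃ k, n = j + k + 1 := ⟨n - j - 1, by omega⟩
    rw [show j + k + 1 - j = k + 1 by omega, scaledPolyA_of_pos (by omega), Nat.add_sub_cancel]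
    push_cast
    ring
  rw [cliquePoly_vertB_succ, ← h]
  ring

lemma cliquePoly_vertB_eq_peakPoly (n : ℕ) : cliquePoly TriAdj (vertB n) = peakPoly n := by
  have h0 : cliquePoly TriAdj (vertB 0) = 1 := by
    rw [show vertB 0 = ∅ by simp [vertB], cliquePoly_empty]
  induction n with
  | zero => rw [h0, peakPoly_zero]
  | succ n ih =>
    rw [peakPoly_succ, ← ih]
    exact succ_of_binomConv (b := fun k => cliquePoly TriAdj (vertB k)) h0 scaledPolyA_zero
      scaledPolyA_succ cliquePoly_vertB_succ_eq_binomConv n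

/-- There is a flag simplicial complex whose `f`-vector is the `γ`-vector of the
type `B_n` Coxeter complex: its number of faces of cardinality `i` is
`4^i · #{w ∈ S_n : pk(0w) = i}`.  (In particular this sequence satisfies the
Kruskal–Katona inequalities.) -/
theorem gamma_typeB_is_f_vector_of_flag_complex (n : ℕ) (hn : 1 ≤ n) :
    ∃ (V : Type) (_ : Fintype V) (_ : DecidableEq V) (Δ : Finset (Finset V)),
      ∅ ∈ Δ ∧
      (∀ F ∈ Δ, ∀ G ⊆ F, G ∈ Δ) ∧
      (∀ v : V, ({v} : Finset V) ∈ Δ) ∧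
      (∀ F : Finset V,
        (∀ a ∈ F, ∀ b ∈ F, a ≠ b → ({a, b} : Finset V) ∈ Δ) → F ∈ Δ) ∧
      (∀ i : ℕ, (Δ.filter fun F => F.card = i).card =
        4 ^ i *
          (Finset.univ.filter fun w : Equiv.Perm (Fin n) => pk n w = i).card) := by
  let r : {x // x ∈ vertB n} → {x // x ∈ vertB n} → Prop := fun x y => TriAdj x y
  have hpoly : cliquePoly r univ = peakPoly n := by
    have h := cliquePoly_map (r := r) (r' := TriAdj)
      (Function.Embedding.subtype fun x => x ∈ vertB n) (fun _ _ => Iff.rfl) univ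
    rw [← cliquePoly_vertB_eq_peakPoly, ← h]
    congr 1
    ext x
    simp
  have hmem : ∀ F, F ∈ cliquesIn r univ ↔ IsCliqueOf r F := fun F => by
    rw [mem_cliquesIn]
    exact and_iff_right (subset_univ F)
  refine ⟨{x // x ∈ vertB n}, inferInstance, inferInstance, cliquesIn r univ, ?_, ?_, ?_, ?_, ?_⟩
  · rw [hmem]
    simp [IsCliqueOf]
  · intro F hF G hG
    rw [hmem] at hF ⊢
    exact fun a ha b hb => hF a (hG ha) b (hG hb)
  · intro v
    rw [hmem]
    simp [IsCliqueOf]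
  · intro F hF
    rw [hmem]
    intro a ha b hb hab
    exact (hmem _).1 (hF a ha b hb hab) a (by simp) b (by simp) hab
  · intro i
    have h := coeff_cliquePoly r univ i
    rw [hpoly, coeff_peakPoly] at h
    exact_mod_cast h.symm
end
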